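/- arXiv:2601.21326 — 3 statements merged into one kernel-verified Lean document; each statement's English description precedes it below -/
import Mathlib

section
/- Let g : Ω → ℂ_J be a proper holomorphic map of degree d between a simply connected domain Ω and a slit plane ℂ_J (J ⊆ ℝ an open interval), with g(Ω ∩ ℝ) ⊆ ℝ and such that the forward orbit of every critical value of g lies in [-1,1] ⊆ J. Then for every i ≥ 0, g⁻ⁱ(ℂ_J) is a connected, simply connected open set, and the sequence (g⁻ⁱ(ℂ_J))_{i≥0} is decreasing. -/
noncomputable section

/-- The plane slit along `ℝ \ A`, for `A ⊆ ℝ`. -/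
def slitC (A : Set ℝ) : Set ℂ :=
  {z : ℂ | z.im ≠ 0} ∪ ((fun x : ℝ => (x : ℂ)) '' A)

section Aux
open Set Filter Topology unitInterval

/-- naturality square -/
def NatSq {X : Type*} [TopologicalSpace X] (f : C(X, X)) (η : ∀ x, Path x (f x)) {x y : X}
    (P : Path.Homotopic.Quotient x y) : Prop :=
  P.trans (.mk (η y)) = Path.Homotopic.Quotient.trans (.mk (η x)) (P.map f)

theorem NatSq.trans {X : Type*} [TopologicalSpace X] {f : C(X, X)} {η : ∀ x, Path x (f x)}
    {x y z : X} {P : Path.Homotopic.Quotient x y} {Q : Path.Homotopic.Quotient y z}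
    (hP : NatSq f η P) (hQ : NatSq f η Q) : NatSq f η (P.trans Q) := by
  unfold NatSq at *
  have : (P.trans Q).map f = (P.map f).trans (Q.map f) := by
    induction P using Path.Homotopic.Quotient.ind
    induction Q using Path.Homotopic.Quotient.ind
    rw [← Path.Homotopic.Quotient.mk_trans, ← Path.Homotopic.Quotient.mk_map,
      ← Path.Homotopic.Quotient.mk_map, ← Path.Homotopic.Quotient.mk_map,
      ← Path.Homotopic.Quotient.mk_trans, Path.map_trans]
  rw [this, Path.Homotopic.Quotient.trans_assoc, hQ, ← Path.Homotopic.Quotient.trans_assoc, hP,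
    Path.Homotopic.Quotient.trans_assoc]

theorem natSq_of_cast {X : Type*} [TopologicalSpace X] {f : C(X, X)} {η : ∀ x, Path x (f x)}
    {x y a b : X} {p : Path x y} (ha : a = x) (hb : b = y)
    (h : NatSq f η (.mk (p.cast ha hb))) : NatSq f η (.mk p) := by
  subst ha hb
  exact h

/-- local naturality implies global naturality -/
theorem nat_global {X : Type*} [TopologicalSpace X] (f : C(X, X))
    (η : ∀ x, Path x (f x))
    (hloc : ∀ x, ∃ N : Set X, IsOpen N ∧ x ∈ N ∧ ∀ (y z : X) (p : Path y z), (∀ t, p t ∈ N) →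
      NatSq f η (.mk p))
    {x y : X} (p : Path x y) : NatSq f η (.mk p) := by
  choose N hNo hxN hN using hloc
  obtain ⟨t, ht0, htm, ⟨n, hn⟩, htc⟩ := exists_monotone_Icc_subset_open_cover_unitInterval
    (c := fun x => p ⁻¹' (N x)) (fun x => (hNo x).preimage p.continuous)
    (fun s _ => mem_iUnion.2 ⟨p s, hxN _⟩)
  have key : ∀ m, NatSq f η (.mk (p.subpath (t 0) (t m))) := by
    intro m
    induction m with
    | zero =>
      rw [Path.subpath_self]
      have : (Path.refl (p (t 0))).map f.continuous = Path.refl _ := by ext; rfl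
      unfold NatSq
      rw [← Path.Homotopic.Quotient.mk_map, this]
      simp
    | succ m ih =>
      obtain ⟨i, hi⟩ := htc m
      have h1 := hN i _ _ (p.subpath (t m) (t (m+1))) (by
        intro s
        have : p.subpath (t m) (t (m+1)) s ∈ range (p.subpath (t m) (t (m+1))) := ⟨s, rfl⟩
        rw [Path.range_subpath_of_le _ _ _ (htm (Nat.le_succ m))] at this
        obtain ⟨u, hu, hu'⟩ := this
        rw [← hu']; exact hi hu)
      have h2 : ((p.subpath (t 0) (t m)).trans (p.subpath (t m) (t (m+1)))).Homotopic
        (p.subpath (t 0) (t (m+1))) := ⟨Path.Homotopy.subpathTransSubpath _ _ _ _⟩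
      rw [← Path.Homotopic.Quotient.eq] at h2
      rw [← h2, Path.Homotopic.Quotient.mk_trans]
      exact ih.trans h1
  have := key n
  rw [hn n le_rfl, ht0] at this
  rw [Path.subpath_zero_one] at this
  exact natSq_of_cast _ _ this

theorem sc_of_nat {X Y : Type*} [TopologicalSpace X] [TopologicalSpace Y] [SimplyConnectedSpace X]
    (i : C(Y, X)) (r : C(X, Y)) (η : ∀ y, Path y ((r.comp i) y))
    (hη : ∀ (x y : Y) (p : Path x y), NatSq (r.comp i) η (.mk p)) : SimplyConnectedSpace Y := by
  rw [simply_connected_iff_paths_homotopic']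
  have hX : PathConnectedSpace X := inferInstance
  constructor
  · refine ⟨⟨r hX.nonempty.some⟩, fun x y => ?_⟩
    refine Joined.trans ⟨η x⟩ (Joined.trans ?_ (Joined.symm ⟨η y⟩))
    exact ⟨(PathConnectedSpace.somePath (i x) (i y)).map r.continuous⟩
  · intro x y p q
    have h1 := hη x y p
    have h2 := hη x y q
    unfold NatSq at h1 h2
    have h3 : (Path.Homotopic.Quotient.mk p).map (r.comp i) =
      (Path.Homotopic.Quotient.mk q).map (r.comp i) := by
      rw [Path.Homotopic.Quotient.map_comp, Path.Homotopic.Quotient.map_comp]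
      congr 1
      exact Subsingleton.elim _ _
    rw [h3, ← h2] at h1
    have h4 := congrArg (fun P => P.trans (.symm (.mk (η y)))) h1
    simp only [Path.Homotopic.Quotient.trans_assoc] at h4
    simp at h4
    exact Path.Homotopic.Quotient.eq.1 h4

theorem sc_of_htpy {X Y : Type*} [TopologicalSpace X] [TopologicalSpace Y] [SimplyConnectedSpace X]
    (i : C(Y, X)) (r : C(X, Y)) (H : (ContinuousMap.id Y).Homotopy (r.comp i)) :
    SimplyConnectedSpace Y := by
  refine sc_of_nat i r (fun y => H.evalAt y) ?_
  intro x y p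
  have := Path.Homotopic.map_trans_evalAt H p
  rw [← Path.Homotopic.Quotient.eq] at this
  exact this

section Lift
variable {W C : Type*} [TopologicalSpace W] [TopologicalSpace C] {g : C(W, C)} {S : Set C}

theorem lift_T1 (cov : IsCoveringMapOn g S) {w w' : C} (c : Path w w') (hc : ∀ t, c t ∈ S)
    {z : W} (hz : g z = w) : ∃ (z' : W) (Γ : Path z z'), ∀ t, g (Γ t) = c t := by
  have cov' := cov.isCoveringMap_restrictPreimage
  have hzS : z ∈ g ⁻¹' S := by
    rw [mem_preimage, hz]; simpa using hc 0
  obtain ⟨Γ, hΓ, hΓ0⟩ := cov'.exists_path_lifts ⟨fun t => (⟨c t, hc t⟩ : S), by fun_prop⟩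
    ⟨z, hzS⟩ (by apply Subtype.ext; simp [hz])
  refine ⟨Γ 1, ⟨⟨fun t => (Γ t : W), by fun_prop⟩, by simp [hΓ0], rfl⟩, fun t => ?_⟩
  have := congrArg Subtype.val (congrFun hΓ t)
  simpa using this

theorem lift_T2 (cov : IsCoveringMapOn g S) (hS : IsSimplyConnected S) {z z₁ z₂ : W}
    (Γ₁ : Path z z₁) (Γ₂ : Path z z₂) (h₁ : ∀ t, g (Γ₁ t) ∈ S) (h₂ : ∀ t, g (Γ₂ t) ∈ S)
    (he : g z₁ = g z₂) : z₁ = z₂ := by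
  have cov' := cov.isCoveringMap_restrictPreimage
  have := hS.simplyConnectedSpace
  have hz : g z ∈ S := by simpa using h₁ 0
  have hz₁ : g z₁ ∈ S := by simpa using h₁ 1
  let c₁ : Path (⟨g z, hz⟩ : S) ⟨g z₁, hz₁⟩ :=
    ⟨⟨fun t => ⟨g (Γ₁ t), h₁ t⟩, by fun_prop⟩, by simp, by simp⟩
  let c₂ : Path (⟨g z, hz⟩ : S) ⟨g z₁, hz₁⟩ :=
    ⟨⟨fun t => ⟨g (Γ₂ t), h₂ t⟩, by fun_prop⟩, by simp, by simp [he]⟩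
  have hc : c₁.Homotopic c₂ := SimplyConnectedSpace.paths_homotopic _ _
  have e := cov'.liftPath_apply_one_eq_of_homotopicRel hc ⟨z, hz⟩ c₁.source c₂.source
  let L₁ : C(I, g ⁻¹' S) := ⟨fun t => ⟨Γ₁ t, h₁ t⟩, by fun_prop⟩
  let L₂ : C(I, g ⁻¹' S) := ⟨fun t => ⟨Γ₂ t, h₂ t⟩, by fun_prop⟩
  have e₁ : L₁ = cov'.liftPath c₁.toContinuousMap ⟨z, hz⟩ c₁.source :=
    (cov'.eq_liftPath_iff' _).2 ⟨rfl, by simp [L₁]⟩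
  have e₂ : L₂ = cov'.liftPath c₂.toContinuousMap ⟨z, hz⟩ c₂.source :=
    (cov'.eq_liftPath_iff' _).2 ⟨rfl, by simp [L₂]⟩
  rw [← e₁, ← e₂] at e
  have := congrArg Subtype.val e
  simpa [L₁, L₂] using this

theorem lift_T3 (cov : IsCoveringMapOn g S) (hS : IsSimplyConnected S) {U : Set C} (hSU : S ⊆ U)
    {z z₁ : ↥(g ⁻¹' U)}
    (Γ₁ Γ₂ : Path z z₁) (h₁ : ∀ t, g (Γ₁ t) ∈ S) (h₂ : ∀ t, g (Γ₂ t) ∈ S) : Γ₁.Homotopic Γ₂ := by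
  have cov' := cov.isCoveringMap_restrictPreimage
  have := hS.simplyConnectedSpace
  have hz : g z ∈ S := by simpa using h₁ 0
  have hz₁ : g z₁ ∈ S := by simpa using h₁ 1
  let L₁ : Path (⟨z, hz⟩ : g ⁻¹' S) ⟨z₁, hz₁⟩ :=
    ⟨⟨fun t => ⟨Γ₁ t, h₁ t⟩, by fun_prop⟩, by simp, by simp⟩
  let L₂ : Path (⟨z, hz⟩ : g ⁻¹' S) ⟨z₁, hz₁⟩ :=
    ⟨⟨fun t => ⟨Γ₂ t, h₂ t⟩, by fun_prop⟩, by simp, by simp⟩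
  have h : Path.Homotopic.Quotient.mk L₁ = Path.Homotopic.Quotient.mk L₂ :=
    cov'.injective_path_homotopic_map _ _ (Subsingleton.elim _ _)
  have h' := (Path.Homotopic.Quotient.eq.1 h).map
    (⟨fun x => ⟨x.1, hSU x.2⟩, by fun_prop⟩ : C(g ⁻¹' S, g ⁻¹' U))
  exact h'

theorem exists_F {K N : Set C} (cov : IsCoveringMapOn g Kᶜ) (hK : IsClosed K) (hN : IsOpen N)
    (hKN : K ⊆ N) (H : C(I × ↥(Kᶜ), ↥(Kᶜ))) (H0 : ∀ w, H (0, w) = w)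
    (HN : ∀ t w, w.1 ∈ N → H (t, w) = w) :
    ∃ F : C(W, W), (∀ z, g z ∈ N → F z = z) ∧
      ∀ z, ∀ hz : g z ∈ Kᶜ, ∃ Γ : Path z (F z), ∀ t, g (Γ t) = H (t, ⟨g z, hz⟩) := by
  classical
  have cov' := cov.isCoveringMap_restrictPreimage
  let q : C(g ⁻¹' Kᶜ, ↥(Kᶜ)) := ⟨_, cov'.continuous⟩
  let Hq : C(I × (g ⁻¹' Kᶜ), ↥(Kᶜ)) := H.comp (ContinuousMap.prodMap (.id I) q)
  have Hq0 : ∀ a, Hq (0, a) = q ((ContinuousMap.id _) a) := fun a => H0 _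
  let G := cov'.liftHomotopy Hq (.id _) Hq0
  have hG0 : ∀ a, G (0, a) = a := fun a => cov'.liftHomotopy_zero Hq (.id _) Hq0 a
  have hGl : ∀ t a, q (G (t, a)) = Hq (t, a) :=
    fun t a => congrFun (cov'.liftHomotopy_lifts Hq (.id _) Hq0) (t, a)
  have hGN : ∀ t a, g a.1 ∈ N → G (t, a) = a := by
    intro t a ha
    have : G (t, a) = G (0, a) := by
      refine cov'.const_of_comp (g := fun s : I => G (s, a)) (by fun_prop) ?_ t 0
      intro s s'
      change q _ = q _
      rw [hGl, hGl]
      exact (HN s (q a) ha).trans (HN s' (q a) ha).symm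
    rw [this, hG0]
  let F : W → W := fun z => if hz : g z ∈ Kᶜ then (G (1, ⟨z, hz⟩)).1 else z
  have hFN : ∀ z, g z ∈ N → F z = z := by
    intro z hz
    by_cases h : g z ∈ Kᶜ
    · simp only [F, dif_pos h]; rw [hGN _ _ hz]
    · simp only [F, dif_neg h]
  have hFc : Continuous F := by
    rw [continuous_iff_continuousAt]
    intro z
    by_cases hz : g z ∈ Kᶜ
    · have ho : IsOpen (g ⁻¹' Kᶜ) := hK.isOpen_compl.preimage g.continuous
      refine (ContinuousOn.continuousAt (s := g ⁻¹' Kᶜ) ?_ (ho.mem_nhds hz))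
      rw [continuousOn_iff_continuous_domRestrict]
      have : (g ⁻¹' Kᶜ).domRestrict F = fun a => (G (1, a)).1 := by
        ext a
        simp only [domRestrict_apply, F, dif_pos (show g a.1 ∈ Kᶜ from a.2)]
      rw [this]; fun_prop
    · have hz' : g z ∈ N := hKN (not_not.1 hz)
      have : F =ᶠ[𝓝 z] id := by
        filter_upwards [(hN.preimage g.continuous).mem_nhds hz'] with y hy
        exact hFN y hy
      exact continuousAt_id.congr this.symm
  refine ⟨⟨F, hFc⟩, hFN, fun z hz => ⟨⟨⟨fun t => (G (t, ⟨z, hz⟩)).1, by fun_prop⟩, ?_, ?_⟩, ?_⟩⟩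
  · simp [hG0]
  · simp only [ContinuousMap.coe_mk, F, dif_pos hz]
  · intro t
    exact congrArg Subtype.val (hGl t ⟨z, hz⟩)

end Lift

theorem path_trans_mem {X : Type*} [TopologicalSpace X] {x y z : X} {p : Path x y} {q : Path y z}
    {s : Set X} (hp : ∀ t, p t ∈ s) (hq : ∀ t, q t ∈ s) (t : I) : p.trans q t ∈ s := by
  rw [Path.trans_apply]
  split_ifs
  · exact hp _
  · exact hq _

theorem homotopic_const_aux {X : Type*} [TopologicalSpace X] {x y x' y' : X} (p : Path x y)
    (p' : Path x' y') (a : Path x x') (b : Path y y') (ha : ∀ t, a t = x) (hb : ∀ t, b t = y)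
    (hp : ∀ t, p' t = p t) : (p.trans b).Homotopic (a.trans p') := by
  have h1 : x' = x := by simpa using ha 1
  have h2 : y' = y := by simpa using hb 1
  subst h1 h2
  have : a = Path.refl _ := by ext t; exact ha t
  subst this
  have : b = Path.refl _ := by ext t; exact hb t
  subst this
  have : p' = p := by ext t; exact hp t
  subst this
  exact (Path.Homotopic.trans_refl _).trans (Path.Homotopic.refl_trans _).symm

theorem abs_sc {W C : Type*} [TopologicalSpace W] [TopologicalSpace C] [SimplyConnectedSpace W]
    (g : C(W, C)) (K U A B N : Set C) (cov : IsCoveringMapOn g Kᶜ)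
    (hK : IsClosed K) (hA : IsClosed A) (hB : IsClosed B) (hAB : ∀ x, x ∈ A ∨ x ∈ B)
    (hN : IsOpen N) (hKN : K ⊆ N) (hNU : N ⊆ U)
    (H : C(I × ↥(Kᶜ), ↥(Kᶜ))) (H0 : ∀ w, H (0, w) = w)
    (HN : ∀ t w, w.1 ∈ N → H (t, w) = w) (H1 : ∀ w, (H (1, w)).1 ∈ U)
    (HA : ∀ t w, w.1 ∈ A → (H (t, w)).1 ∈ A) (HB : ∀ t w, w.1 ∈ B → (H (t, w)).1 ∈ B)
    (HAB : ∀ t w, w.1 ∈ U → w.1 ∈ A → w.1 ∈ B → (H (t, w)).1 ∈ U)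
    (sA : IsSimplyConnected (A \ K)) (sB : IsSimplyConnected (B \ K))
    (sUA : IsSimplyConnected ((U ∩ A) \ K)) (sUB : IsSimplyConnected ((U ∩ B) \ K))
    (hD : ∀ x ∈ U, x ∈ A → x ∈ B → x ∉ K → ∃ D, IsOpen D ∧ x ∈ D ∧ D ⊆ U \ K ∧
      IsSimplyConnected D ∧ IsPathConnected (D ∩ A) ∧ IsPathConnected (D ∩ B)) :
    IsSimplyConnected (g ⁻¹' U) := by
  obtain ⟨F, hFN, hF⟩ := exists_F cov hK hN hKN H H0 HN
  have hFU : ∀ z, F z ∈ g ⁻¹' U := by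
    intro z
    by_cases hz : g z ∈ Kᶜ
    · obtain ⟨Γ, hΓ⟩ := hF z hz
      have := hΓ 1
      rw [Γ.target] at this
      rw [mem_preimage, this]; exact H1 _
    · have hz' : g z ∈ N := hKN (not_not.1 hz)
      rw [hFN z hz']; exact hNU hz'
  let i : C(g ⁻¹' U, W) := ⟨Subtype.val, by fun_prop⟩
  let r : C(W, g ⁻¹' U) := ⟨fun z => ⟨F z, hFU z⟩, by fun_prop⟩
  -- existence of a one-sided path
  have side : ∀ A : Set C, IsSimplyConnected (A \ K) → IsSimplyConnected ((U ∩ A) \ K) →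
      (∀ t w, w.1 ∈ A → (H (t, w)).1 ∈ A) → ∀ z, g z ∈ U → g z ∈ A → g z ∉ K →
      ∃ Γ : Path z (F z), ∀ t, g (Γ t) ∈ (U ∩ A) \ K := by
    intro A sA sUA HA z hzU hzA hzK
    obtain ⟨Γ, hΓ⟩ := hF z hzK
    have h1 : g (F z) ∈ (U ∩ A) \ K := by
      have := hΓ 1
      rw [Γ.target] at this
      exact ⟨⟨hFU z, this ▸ HA 1 ⟨g z, hzK⟩ hzA⟩, this ▸ (H (1, ⟨g z, hzK⟩)).2⟩
    obtain ⟨c, hc⟩ := sUA.isPathConnected.joinedIn (g z) ⟨⟨hzU, hzA⟩, hzK⟩ _ h1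
    obtain ⟨z', L, hL⟩ := lift_T1 (cov.mono (t := (U ∩ A) \ K) (fun x hx => hx.2)) c hc rfl
    have e : z' = F z := by
      refine lift_T2 (cov.mono (t := A \ K) (fun x hx => hx.2)) sA L Γ ?_ ?_ ?_
      · intro t; rw [hL]; exact ⟨(hc t).1.2, (hc t).2⟩
      · intro t; rw [hΓ]; exact ⟨HA t ⟨g z, hzK⟩ hzA, (H (t, ⟨g z, hzK⟩)).2⟩
      · have := hL 1
        rw [L.target, c.target] at this
        exact this
    subst e
    exact ⟨L, fun t => by rw [hL]; exact hc t⟩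
  have ex : ∀ z : g ⁻¹' U, ∃ Γ : Path z ((r.comp i) z), (g z ∈ N → ∀ t, Γ t = z) ∧
      (g z ∈ A \ K → ∀ t, g (Γ t) ∈ (U ∩ A) \ K) ∧ (g z ∈ B \ K → ∀ t, g (Γ t) ∈ (U ∩ B) \ K) := by
    rintro ⟨z, hz⟩
    have hz' : g z ∈ U := hz
    suffices h : ∃ Γ : Path z (F z), (∀ t, g (Γ t) ∈ U) ∧ (g z ∈ N → ∀ t, Γ t = z) ∧
      (g z ∈ A \ K → ∀ t, g (Γ t) ∈ (U ∩ A) \ K) ∧ (g z ∈ B \ K → ∀ t, g (Γ t) ∈ (U ∩ B) \ K) by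
      obtain ⟨Γ, h0, h1, h2⟩ := h
      refine ⟨⟨⟨fun t => ⟨Γ t, h0 t⟩, by fun_prop⟩, ?_, ?_⟩, fun h t => ?_, h2⟩
      · simp
      · simp [r, i]
      · exact Subtype.ext (h1 h t)
    by_cases hzN : g z ∈ N
    · refine ⟨(Path.refl z).cast rfl (hFN z hzN), ?_, ?_, ?_, ?_⟩
      · intro t; exact hz
      · intro _ t; rfl
      · intro h t; exact ⟨⟨hz', h.1⟩, h.2⟩
      · intro h t; exact ⟨⟨hz', h.1⟩, h.2⟩
    have hzK : g z ∉ K := fun h => hzN (hKN h)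
    by_cases hzA : g z ∈ A
    · by_cases hzB : g z ∈ B
      · obtain ⟨Γ, hΓ⟩ := hF z hzK
        have hu : ∀ t, g (Γ t) ∈ U := fun t => by rw [hΓ]; exact HAB t ⟨g z, hzK⟩ hz' hzA hzB
        refine ⟨Γ, hu, fun h => absurd h hzN, fun h t => ⟨⟨hu t, ?_⟩, ?_⟩,
          fun h t => ⟨⟨hu t, ?_⟩, ?_⟩⟩
        · rw [hΓ]; exact HA t ⟨g z, hzK⟩ hzA
        · rw [hΓ]; exact (H (t, ⟨g z, hzK⟩)).2
        · rw [hΓ]; exact HB t ⟨g z, hzK⟩ hzB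
        · rw [hΓ]; exact (H (t, ⟨g z, hzK⟩)).2
      · obtain ⟨Γ, hΓ⟩ := side A sA sUA HA z hz' hzA hzK
        exact ⟨Γ, fun t => (hΓ t).1.1, fun h => absurd h hzN, fun _ => hΓ, fun h => absurd h.1 hzB⟩
    · have hzB : g z ∈ B := (hAB _).resolve_left hzA
      obtain ⟨Γ, hΓ⟩ := side B sB sUB HB z hz' hzB hzK
      exact ⟨Γ, fun t => (hΓ t).1.1, fun h => absurd h hzN, fun h => absurd h.1 hzA, fun _ => hΓ⟩
  choose η ηN ηA ηB using ex
  -- naturality for one-sided paths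
  have nat1 : ∀ S : Set C, IsSimplyConnected S → S ⊆ U \ K →
      (∀ z : g ⁻¹' U, g z ∈ S → ∀ t, g (η z t) ∈ S) → ∀ (x y : g ⁻¹' U) (p : Path x y),
      (∀ t, g (p t) ∈ S) → NatSq (r.comp i) η (.mk p) := by
    intro S sS hS hη x y p hp
    have hfS : ∀ z : g ⁻¹' U, g z ∈ S → g ((r.comp i) z) ∈ S := by
      intro z hz
      have := hη z hz 1
      rwa [(η z).target] at this
    have hx : g x ∈ S := by simpa using hp 0
    have hy : g y ∈ S := by simpa using hp 1
    have := lift_T3 (cov.mono (t := S) (fun x hx => (hS hx).2)) sS (fun x hx => (hS hx).1)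
      (p.trans (η y)) ((η x).trans (p.map (r.comp i).continuous))
      (path_trans_mem (s := {v : g ⁻¹' U | g v.1 ∈ S}) hp (hη y hy))
      (path_trans_mem (s := {v : g ⁻¹' U | g v.1 ∈ S}) (hη x hx) (fun t => hfS _ (hp t)))
    unfold NatSq
    rw [← Path.Homotopic.Quotient.eq] at this
    exact this
  have natA : ∀ (x y : g ⁻¹' U) (p : Path x y), (∀ t, g (p t) ∈ (U ∩ A) \ K) →
      NatSq (r.comp i) η (.mk p) :=
    nat1 _ sUA (fun x hx => ⟨hx.1.1, hx.2⟩) (fun z hz => ηA z ⟨hz.1.2, hz.2⟩)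
  have natB : ∀ (x y : g ⁻¹' U) (p : Path x y), (∀ t, g (p t) ∈ (U ∩ B) \ K) →
      NatSq (r.comp i) η (.mk p) :=
    nat1 _ sUB (fun x hx => ⟨hx.1.1, hx.2⟩) (fun z hz => ηB z ⟨hz.1.2, hz.2⟩)
  have gi : Continuous (fun z : g ⁻¹' U => g z) := by fun_prop
  suffices SimplyConnectedSpace (g ⁻¹' U) from this
  refine sc_of_nat i r η (fun x y p => nat_global (r.comp i) η ?_ p)
  intro z
  have hzU : g z ∈ U := z.2
  by_cases hzN : g z ∈ N
  · refine ⟨_, hN.preimage gi, hzN, fun x y p hp => ?_⟩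
    have hx : g x ∈ N := by simpa using hp 0
    have hy : g y ∈ N := by simpa using hp 1
    have := homotopic_const_aux p (p.map (r.comp i).continuous) (η x) (η y) (ηN x hx) (ηN y hy)
      (fun t => Subtype.ext (hFN (p t) (hp t)))
    rw [← Path.Homotopic.Quotient.eq] at this
    exact this
  have hzK : g z ∉ K := fun h => hzN (hKN h)
  by_cases hzB : g z ∈ B
  · by_cases hzA : g z ∈ A
    · obtain ⟨D, hDo, hzD, hDU, sD, dA, dB⟩ := hD _ hzU hzA hzB hzK
      refine ⟨_, hDo.preimage gi, hzD, fun x y p hp => ?_⟩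
      have hx : g x ∈ D := by simpa using hp 0
      have hy : g y ∈ D := by simpa using hp 1
      -- a path in D from w to the centre, on one side
      have cpath : ∀ w ∈ D, ∃ c : Path w (g z), (∀ t, c t ∈ D) ∧
          ((∀ t, c t ∈ (U ∩ A) \ K) ∨ (∀ t, c t ∈ (U ∩ B) \ K)) := by
        intro w hw
        rcases hAB w with hwA | hwB
        · obtain ⟨c, hc⟩ := dA.joinedIn w ⟨hw, hwA⟩ _ ⟨hzD, hzA⟩
          exact ⟨c, fun t => (hc t).1, Or.inl fun t =>
            ⟨⟨(hDU (hc t).1).1, (hc t).2⟩, (hDU (hc t).1).2⟩⟩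
        · obtain ⟨c, hc⟩ := dB.joinedIn w ⟨hw, hwB⟩ _ ⟨hzD, hzB⟩
          exact ⟨c, fun t => (hc t).1, Or.inr fun t =>
            ⟨⟨(hDU (hc t).1).1, (hc t).2⟩, (hDU (hc t).1).2⟩⟩
      obtain ⟨c₁, hc₁D, hc₁⟩ := cpath _ hx
      obtain ⟨c₂, hc₂D, hc₂⟩ := cpath _ hy
      have covD := cov.mono (t := D) (fun x hx => (hDU hx).2)
      obtain ⟨u, L₁, hL₁⟩ := lift_T1 covD c₁ hc₁D (z := x.1) rfl
      have hu : g u = g z := by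
        have := hL₁ 1
        rwa [L₁.target, c₁.target] at this
      obtain ⟨v, L₂, hL₂⟩ := lift_T1 covD c₂.symm (fun t => hc₂D _) (z := u) hu
      have hv : v = y.1 := by
        refine lift_T2 covD sD (L₁.trans L₂) (p.map i.continuous) ?_ hp ?_
        · exact path_trans_mem (s := {v | g v ∈ D}) (fun t => by
            change g _ ∈ D; rw [hL₁]; exact hc₁D t) (fun t => by
            change g _ ∈ D; rw [hL₂]; exact hc₂D _)
        · have := hL₂ 1
          rwa [L₂.target, c₂.symm.target] at this
      subst hv
      have hDU' : ∀ w ∈ D, w ∈ U := fun w hw => (hDU hw).1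
      let u' : g ⁻¹' U := ⟨u, by rw [mem_preimage, hu]; exact hzU⟩
      let M₁ : Path x u' := ⟨⟨fun t => ⟨L₁ t, by
        rw [mem_preimage, hL₁]; exact hDU' _ (hc₁D t)⟩, by fun_prop⟩, by simp, by simp [u']⟩
      let M₂ : Path u' y := ⟨⟨fun t => ⟨L₂ t, by
        rw [mem_preimage, hL₂]; exact hDU' _ (hc₂D _)⟩, by fun_prop⟩, by simp [u'], by simp⟩
      have hM₁ : ∀ t, g (M₁ t) = c₁ t := hL₁
      have hM₂ : ∀ t, g (M₂ t) = c₂.symm t := hL₂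
      have hom := lift_T3 covD sD hDU' p (M₁.trans M₂) hp
        (path_trans_mem (s := {v : g ⁻¹' U | g v ∈ D}) (fun t => by
            change g _ ∈ D; rw [hM₁]; exact hc₁D t) (fun t => by
            change g _ ∈ D; rw [hM₂]; exact hc₂D _))
      rw [← Path.Homotopic.Quotient.eq, Path.Homotopic.Quotient.mk_trans] at hom
      rw [hom]
      refine NatSq.trans ?_ ?_
      · rcases hc₁ with h | h
        · exact natA _ _ _ fun t => by rw [hM₁]; exact h t
        · exact natB _ _ _ fun t => by rw [hM₁]; exact h t
      · rcases hc₂ with h | h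
        · exact natA _ _ _ fun t => by rw [hM₂]; exact h _
        · exact natB _ _ _ fun t => by rw [hM₂]; exact h _
    · refine ⟨_, (hA.isOpen_compl.inter hK.isOpen_compl).preimage gi, ⟨hzA, hzK⟩,
        fun x y p hp => natB x y p fun t => ⟨⟨(p t).2, (hAB _).resolve_left (hp t).1⟩, (hp t).2⟩⟩
  · refine ⟨_, (hB.isOpen_compl.inter hK.isOpen_compl).preimage gi, ⟨hzB, hzK⟩,
        fun x y p hp => natA x y p fun t => ⟨⟨(p t).2, (hAB _).resolve_right (hp t).1⟩, (hp t).2⟩⟩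

theorem mem_II {z : ℂ} : z ∈ (fun x : ℝ => (x : ℂ)) '' Icc (-1 : ℝ) 1 ↔
    z.im = 0 ∧ -1 ≤ z.re ∧ z.re ≤ 1 := by
  constructor
  · rintro ⟨x, hx, rfl⟩
    simpa using hx
  · rintro ⟨h, h1, h2⟩
    exact ⟨z.re, ⟨h1, h2⟩, Complex.ext rfl h.symm⟩

theorem isClosed_II : IsClosed ((fun x : ℝ => (x : ℂ)) '' Icc (-1 : ℝ) 1) :=
  (isCompact_Icc.image Complex.continuous_ofReal).isClosed

/-- upper half of a symmetric simply connected domain, minus the interval -/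
theorem half_sc {U : Set ℂ} (hU : IsOpen U) (hne : Uᶜ.Nonempty)
    (hsym : ∀ z ∈ U, (starRingEnd ℂ) z ∈ U) [SimplyConnectedSpace U] (E : Set ℂ)
    (hE : ∀ z ∈ E, z.im = 0) :
    IsSimplyConnected ((U ∩ {z | 0 ≤ z.im}) \ E) := by
  set Y := (U ∩ {z : ℂ | 0 ≤ z.im}) \ E with hY
  let w : ℂ → ℂ := fun z => ⟨z.re, |z.im|⟩
  have hwc : Continuous w := by
    have : w = fun z => (z.re : ℂ) + (|z.im| : ℝ) * Complex.I := by
      funext z; apply Complex.ext <;> simp [w]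
    rw [this]; fun_prop
  have hwU : ∀ z ∈ U, w z ∈ U := by
    intro z hz
    rcases abs_cases z.im with ⟨h, _⟩ | ⟨h, _⟩
    · have : w z = z := by apply Complex.ext <;> simp [w, h]
      rwa [this]
    · have : w z = (starRingEnd ℂ) z := by apply Complex.ext <;> simp [w, h]
      rw [this]; exact hsym z hz
  let ε : ℂ → ℝ := fun z => Metric.infDist (w z) Uᶜ / 2
  have hεc : Continuous ε := by
    have := (Metric.continuous_infDist_pt Uᶜ).comp hwc
    exact this.div_const 2
  have hεpos : ∀ z ∈ U, 0 < ε z := by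
    intro z hz
    have : 0 < Metric.infDist (w z) Uᶜ :=
      (hU.isClosed_compl.notMem_iff_infDist_pos hne).1 (by simpa using hwU z hz)
    simp only [ε]; linarith
  let q : ℝ → ℂ → ℂ := fun t z => w z + ((t * ε z : ℝ) : ℂ) * Complex.I
  have hqU : ∀ t ∈ Icc (0:ℝ) 1, ∀ z ∈ U, q t z ∈ U := by
    intro t ht z hz
    by_contra hcon
    have h1 := Metric.infDist_le_dist_of_mem (x := w z) (s := Uᶜ) hcon
    have h2 : dist (w z) (q t z) = t * ε z := by
      simp only [q, dist_self_add_right, norm_mul, Complex.norm_real, Complex.norm_I, mul_one]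
      rw [Real.norm_of_nonneg ht.1, Real.norm_of_nonneg (hεpos z hz).le]
    have h3 := hεpos z hz
    have h4 : Metric.infDist (w z) Uᶜ = 2 * ε z := by simp only [ε]; ring
    nlinarith [ht.2]
  have hqim : ∀ t z, (q t z).im = |z.im| + t * ε z := by intro t z; simp [q, w]
  have hq1 : ∀ z ∈ U, q 1 z ∈ Y := by
    intro z hz
    have h3 := hεpos z hz
    have := hqim 1 z
    have h4 := abs_nonneg z.im
    refine ⟨⟨hqU 1 (by simp) z hz, ?_⟩, fun h => ?_⟩
    · simp only [mem_ofPred_eq]; linarith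
    · have := hE _ h; linarith
  have hqY : ∀ t ∈ Icc (0:ℝ) 1, ∀ z ∈ Y, q t z ∈ Y := by
    intro t ht z hz
    have h3 := hεpos z hz.1.1
    have := hqim t z
    have h4 := abs_nonneg z.im
    have h5 : 0 ≤ t * ε z := mul_nonneg ht.1 h3.le
    refine ⟨⟨hqU t ht z hz.1.1, ?_⟩, fun h => ?_⟩
    · simp only [mem_ofPred_eq]; linarith
    · have h6 := hE _ h
      have h7 : t * ε z = 0 := by linarith
      have h8 : w z = z := by
        apply Complex.ext <;> simp [w]
        exact hz.1.2
      have h9 : q t z = z := by simp only [q, h7, h8]; simp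
      rw [h9] at h
      exact hz.2 h
  have hqc : Continuous (fun p : ℝ × ℂ => q p.1 p.2) := by
    simp only [q]; fun_prop
  have hq0 : ∀ z ∈ Y, q 0 z = z := by
    intro z hz
    have h8 : w z = z := by
      apply Complex.ext <;> simp [w]
      exact hz.1.2
    simp [q, h8]
  let i : C(Y, U) := ⟨fun z => ⟨z.1, z.2.1.1⟩, by fun_prop⟩
  let r : C(U, Y) := ⟨fun z => ⟨q 1 z, hq1 z z.2⟩, by
    apply Continuous.subtype_mk
    exact hqc.comp (f := fun z : U => ((1:ℝ), (z:ℂ))) (by fun_prop)⟩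
  refine sc_of_htpy i r ⟨⟨fun p => ⟨q p.1 p.2, hqY p.1 p.1.2 p.2 p.2.2⟩, ?_⟩, ?_, ?_⟩
  · apply Continuous.subtype_mk
    exact hqc.comp (f := fun p : I × Y => ((p.1:ℝ), (p.2:ℂ))) (by fun_prop)
  · intro z; apply Subtype.ext; simp [hq0 z z.2]
  · intro z; apply Subtype.ext; simp [r, i]

theorem half_sc' {U : Set ℂ} (hU : IsOpen U) (hne : Uᶜ.Nonempty)
    (hsym : ∀ z ∈ U, (starRingEnd ℂ) z ∈ U) [SimplyConnectedSpace U] (E : Set ℂ)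
    (hE : ∀ z ∈ E, z.im = 0) :
    IsSimplyConnected ((U ∩ {z | z.im ≤ 0}) \ E) := by
  have h := half_sc hU hne hsym E hE
  rw [← Complex.conjLIE.toHomeomorph.isSimplyConnected_image] at h
  convert h using 1
  ext z
  simp only [Set.mem_sdiff, mem_inter_iff, mem_ofPred_eq, mem_image]
  constructor
  · rintro ⟨⟨h1, h2⟩, h3⟩
    refine ⟨(starRingEnd ℂ) z, ⟨⟨hsym z h1, by simpa using h2⟩, fun h => h3 ?_⟩, by simp⟩
    have := hE _ h
    have e : (starRingEnd ℂ) z = z := by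
      rw [Complex.conj_eq_iff_im]; simpa using this
    rwa [e] at h
  · rintro ⟨y, ⟨⟨h1, h2⟩, h3⟩, rfl⟩
    refine ⟨⟨hsym y h1, by simpa using h2⟩, fun h => h3 ?_⟩
    have := hE _ h
    have e : (starRingEnd ℂ) y = y := by
      rw [Complex.conj_eq_iff_im]; simpa using this
    have h' : (starRingEnd ℂ) y ∈ E := h
    rwa [e] at h'

theorem log_const {S : Set ℂ} (hS : IsPreconnected S) (p c : ℂ) (hc : c ≠ 0)
    (hsl : ∀ z ∈ S, (z - p) * c ∈ Complex.slitPlane) (L : ℂ → ℂ) (hL : ContinuousOn L S)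
    (hexp : ∀ z ∈ S, Complex.exp (L z) = z - p) {x y : ℂ} (hx : x ∈ S) (hy : y ∈ S) :
    L x - Complex.log ((x - p) * c) = L y - Complex.log ((y - p) * c) := by
  have hd : IsDiscrete (Complex.exp ⁻¹' {c⁻¹}) := by
    rw [isDiscrete_iff_discreteTopology]
    exact (Complex.isCoveringMapOn_exp c⁻¹ (by simpa using hc)).1
  refine hS.constant_of_mapsTo hd (f := fun z => L z - Complex.log ((z - p) * c)) ?_ ?_ hx hy
  · refine hL.sub (ContinuousOn.clog (by fun_prop) hsl)
  · intro z hz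
    have h0 := Complex.slitPlane_ne_zero (hsl z hz)
    have h1 : z - p ≠ 0 := left_ne_zero_of_mul h0
    simp only [mem_preimage, mem_singleton_iff]
    rw [Complex.exp_sub, hexp z hz, Complex.exp_log h0]
    field_simp

theorem real_slice {U : Set ℂ} (hU : IsOpen U)
    (hsym : ∀ z ∈ U, (starRingEnd ℂ) z ∈ U) [SimplyConnectedSpace U] {x p y : ℝ}
    (hx : (x : ℂ) ∈ U) (hy : (y : ℂ) ∈ U) (hxp : x < p) (hpy : p < y) : (p : ℂ) ∈ U := by
  by_contra hp
  have hA := (half_sc hU ⟨_, hp⟩ hsym ∅ (by simp)).isPathConnected.isConnected.isPreconnected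
  have hB := (half_sc' hU ⟨_, hp⟩ hsym ∅ (by simp)).isPathConnected.isConnected.isPreconnected
  have hne : ∀ z ∈ U, z - p ∈ ({0}ᶜ : Set ℂ) := by
    intro z hz h
    rw [mem_singleton_iff, sub_eq_zero] at h
    exact hp (h ▸ hz)
  have : LocallyPathConnectedSpace U := hU.locallyPathConnectedSpace
  have cov := Complex.isCoveringMapOn_exp.isCoveringMap_restrictPreimage
  let f : C(U, ({0}ᶜ : Set ℂ)) := ⟨fun z => ⟨z - p, hne z z.2⟩, by fun_prop⟩
  obtain ⟨F, ⟨-, hF⟩, -⟩ := cov.existsUnique_continuousMap_lifts f ⟨x, hx⟩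
    ⟨Complex.log ((x : ℂ) - p), by simp⟩ (by
      apply Subtype.ext
      simp only [restrictPreimage_coe, f, ContinuousMap.coe_mk]
      exact Complex.exp_log (hne _ hx))
  classical
  let L : ℂ → ℂ := fun z => if h : z ∈ U then (F ⟨z, h⟩ : ℂ) else 0
  have hL : ContinuousOn L U := by
    rw [continuousOn_iff_continuous_domRestrict]
    have : U.domRestrict L = fun z => (F z : ℂ) := by
      funext z; simp [L]
    rw [this]; fun_prop
  have hexp : ∀ z ∈ U, Complex.exp (L z) = z - p := by
    intro z hz
    have := congrArg Subtype.val (congrFun hF ⟨z, hz⟩)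
    simpa [L, hz, f] using this
  have key : ∀ r : ℝ, r ≠ 0 → ∀ v : ℝ, 0 ≤ v → ∀ u : ℝ, (v = 0 → u ≠ 0) →
    (⟨v, u⟩ : ℂ) ∈ Complex.slitPlane := by
    intro r _ v hv u hu
    rw [Complex.mem_slitPlane_iff]
    rcases hv.lt_or_eq with h | h
    · exact Or.inl h
    · exact Or.inr (hu h.symm)
  have hne' : ∀ z ∈ U, z.im = 0 → z.re - p ≠ 0 := by
    intro z hz h h'
    apply hne z hz
    apply Complex.ext <;> simp [h, h']
  have e1 := log_const hA (p : ℂ) (-Complex.I) (by simp) (by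
    rintro z ⟨⟨hz, him⟩, -⟩
    have him : 0 ≤ z.im := him
    have : (z - p) * (-Complex.I) = ⟨z.im, -(z.re - p)⟩ := by apply Complex.ext <;> simp
    rw [this]
    exact key 1 one_ne_zero _ him _ (fun h => neg_ne_zero.2 (hne' z hz h)))
    L (hL.mono fun z hz => hz.1.1) (fun z hz => hexp z hz.1.1) (x := x) (y := y)
    ⟨⟨hx, by simp⟩, by simp⟩ ⟨⟨hy, by simp⟩, by simp⟩
  have e2 := log_const hB (p : ℂ) (Complex.I) (by simp) (by
    rintro z ⟨⟨hz, him⟩, -⟩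
    have him : z.im ≤ 0 := him
    have : (z - p) * (Complex.I) = ⟨-z.im, (z.re - p)⟩ := by apply Complex.ext <;> simp
    rw [this]
    exact key 1 one_ne_zero _ (neg_nonneg.2 him) _ (fun h => (hne' z hz (neg_eq_zero.1 h))))
    L (hL.mono fun z hz => hz.1.1) (fun z hz => hexp z hz.1.1) (x := x) (y := y)
    ⟨⟨hx, by simp⟩, by simp⟩ ⟨⟨hy, by simp⟩, by simp⟩
  have a1 : ((x : ℂ) - p) * (-Complex.I) = ((p - x : ℝ) : ℂ) * Complex.I := by push_cast; ring
  have a2 : ((y : ℂ) - p) * (-Complex.I) = ((y - p : ℝ) : ℂ) * (-Complex.I) := by push_cast; ring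
  have a3 : ((x : ℂ) - p) * (Complex.I) = ((p - x : ℝ) : ℂ) * (-Complex.I) := by push_cast; ring
  have a4 : ((y : ℂ) - p) * (Complex.I) = ((y - p : ℝ) : ℂ) * Complex.I := by push_cast; ring
  rw [a1, a2] at e1
  rw [a3, a4] at e2
  have b1 := congrArg Complex.im e1
  have b2 := congrArg Complex.im e2
  simp only [Complex.sub_im, Complex.log_im, Complex.arg_real_mul _ (sub_pos.2 hxp),
    Complex.arg_real_mul _ (sub_pos.2 hpy), Complex.arg_I, Complex.arg_neg_I] at b1 b2
  have := Real.pi_pos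
  linarith

theorem conj_sym {Ω S : Set ℂ} (hΩ : IsOpen Ω) (hconn : IsPreconnected Ω) (h0 : (0 : ℂ) ∈ Ω)
    (hS : IsOpen S) (hsym : ∀ z ∈ S, (starRingEnd ℂ) z ∈ S)
    (g : ℂ → ℂ) (hhol : DifferentiableOn ℂ g Ω) (hmaps : MapsTo g Ω S)
    (hproper : ∀ K : Set ℂ, K ⊆ S → IsCompact K → IsCompact {z ∈ Ω | g z ∈ K})
    (hreal : ∀ z ∈ Ω, z.im = 0 → (g z).im = 0) :
    ∀ z ∈ Ω, (starRingEnd ℂ) z ∈ Ω ∧ g ((starRingEnd ℂ) z) = (starRingEnd ℂ) (g z) := by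
  let cj : ℂ → ℂ := fun z => (starRingEnd ℂ) z
  have cjc : Continuous cj := Complex.continuous_conj
  have cjj : ∀ z, cj (cj z) = z := fun z => Complex.conj_conj z
  let gs : ℂ → ℂ := fun z => cj (g (cj z))
  have an : ∀ z ∈ Ω, AnalyticAt ℂ g z := fun z hz => hhol.analyticAt (hΩ.mem_nhds hz)
  have ans : ∀ z, cj z ∈ Ω → AnalyticAt ℂ gs z := by
    intro z hz
    have hd : DifferentiableOn ℂ gs (cj ⁻¹' Ω) := by
      intro w hw
      have h1 : DifferentiableAt ℂ g (cj w) := (hhol _ hw).differentiableAt (hΩ.mem_nhds hw)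
      have := h1.star_star
      have e : star (cj w) = w := cjj w
      rw [e] at this
      exact this.differentiableWithinAt
    exact hd.analyticAt ((hΩ.preimage cjc).mem_nhds hz)
  let T : Set ℂ := {z | z ∈ Ω ∧ cj z ∈ Ω ∧ g =ᶠ[𝓝 z] gs}
  have hT : IsOpen T := by
    rw [isOpen_iff_mem_nhds]
    rintro z ⟨h1, h2, h3⟩
    filter_upwards [hΩ.mem_nhds h1, (hΩ.preimage cjc).mem_nhds h2, h3.eventually_nhds] with w a b c
    exact ⟨a, b, c⟩
  have h0T : (0 : ℂ) ∈ T := by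
    have hc0 : cj 0 ∈ Ω := by simpa [cj] using h0
    refine ⟨h0, hc0, ?_⟩
    refine ((an 0 h0).frequently_eq_iff_eventually_eq (ans 0 hc0)).1 ?_
    have ht : Tendsto (fun x : ℝ => (x : ℂ)) (𝓝[≠] 0) (𝓝[≠] 0) := by
      refine tendsto_nhdsWithin_iff.2 ⟨?_, ?_⟩
      · exact (Complex.continuous_ofReal.tendsto' 0 0 (by simp)).mono_left nhdsWithin_le_nhds
      · filter_upwards [self_mem_nhdsWithin] with x hx
        simpa using hx
    refine ht.frequently (Eventually.frequently ?_)
    have : ∀ᶠ x : ℝ in 𝓝[≠] 0, (x : ℂ) ∈ Ω :=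
      (ht.mono_right nhdsWithin_le_nhds).eventually (hΩ.mem_nhds h0)
    filter_upwards [this] with x hx
    have := hreal _ hx (by simp)
    simp only [gs, cj, Complex.conj_ofReal]
    exact (Complex.conj_eq_iff_im.2 this).symm
  have hcl : closure T ∩ Ω ⊆ T := by
    rintro z ⟨hzT, hz⟩
    by_contra hzn
    obtain ⟨ρ, hρ, hk⟩ := Metric.isOpen_iff.1 hS _ (hmaps hz)
    let k := Metric.closedBall (g z) (ρ/2)
    have hkS : k ⊆ S := (Metric.closedBall_subset_ball (by linarith)).trans hk
    have hkc : IsCompact (cj '' k) := (isCompact_closedBall _ _).image cjc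
    have hM := hproper (cj '' k) (by rintro _ ⟨w, hw, rfl⟩; exact hsym _ (hkS hw)) hkc
    have hN : g ⁻¹' k ∈ 𝓝 z := (an z hz).continuousAt (Metric.closedBall_mem_nhds _ (by linarith))
    have hcz : cj z ∈ {w ∈ Ω | g w ∈ cj '' k} := by
      have h1 : z ∈ closure (g ⁻¹' k ∩ T) := by
        rw [mem_closure_iff_nhds] at hzT ⊢
        intro t ht
        obtain ⟨w, ⟨a, b⟩, c⟩ := hzT _ (inter_mem ht hN)
        exact ⟨w, a, b, c⟩
      have h2 : MapsTo cj (g ⁻¹' k ∩ T) {w ∈ Ω | g w ∈ cj '' k} := by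
        rintro w ⟨hw, hw1, hw2, hw3⟩
        refine ⟨hw2, g w, hw, ?_⟩
        have := hw3.self_of_nhds
        simp only [gs] at this
        rw [this, cjj]
      exact hM.isClosed.closure_subset (map_mem_closure cjc h1 h2)
    apply hzn
    refine ⟨hz, hcz.1, ?_⟩
    refine ((an z hz).frequently_eq_iff_eventually_eq (ans z hcz.1)).1 ?_
    have h1 : ∃ᶠ w in 𝓝 z, w ∈ T := mem_closure_iff_frequently.1 hzT
    have h2 : ∃ᶠ w in 𝓝[≠] z, w ∈ T := by
      rw [frequently_nhdsWithin_iff]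
      exact h1.mono fun w hw => ⟨hw, fun h => hzn (by rw [mem_singleton_iff] at h; rwa [← h])⟩
    exact h2.mono fun w hw => hw.2.2.self_of_nhds
  have := hconn.subset_of_closure_inter_subset hT ⟨0, h0, h0T⟩ hcl
  intro z hz
  obtain ⟨h1, h2, h3⟩ := this hz
  refine ⟨h2, ?_⟩
  have := h3.self_of_nhds
  change g (cj z) = cj (g z)
  rw [this]
  simp only [gs, cjj]

theorem cov_of_proper {Ω S E : Set ℂ} (hΩ : IsOpen Ω)
    (hS : IsOpen S) (g : ℂ → ℂ) (hhol : DifferentiableOn ℂ g Ω)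
    (hproper : ∀ K : Set ℂ, K ⊆ S → IsCompact K → IsCompact {z ∈ Ω | g z ∈ K})
    (hcrit : ∀ z ∈ Ω, deriv g z = 0 → g z ∈ E) (gW : C(Ω, S)) (hgW : ∀ z, (gW z : ℂ) = g z) :
    IsCoveringMapOn gW (Subtype.val ⁻¹' E : Set S)ᶜ := by
  have hp : ∀ ⦃K : Set S⦄, IsCompact K → IsCompact (gW ⁻¹' K) := by
    intro K hK
    have h1 := hproper (Subtype.val '' K) (by rintro _ ⟨w, -, rfl⟩; exact w.2)
      (hK.image continuous_subtype_val)
    rw [Subtype.isCompact_iff]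
    convert h1 using 1
    ext z
    constructor
    · rintro ⟨w, hw, rfl⟩
      exact ⟨w.2, gW w, hw, hgW w⟩
    · rintro ⟨hz, w, hw, h⟩
      refine ⟨⟨z, hz⟩, ?_, rfl⟩
      have : w = gW ⟨z, hz⟩ := Subtype.ext (by rw [h, hgW])
      rw [mem_preimage, ← this]; exact hw
  have : LocallyCompactSpace S := hS.locallyCompactSpace
  have hprop : IsProperMap gW := isProperMap_iff_isCompact_preimage.2 ⟨gW.continuous, hp⟩
  have hl : IsLocalHomeomorphOn gW (gW ⁻¹' (Subtype.val ⁻¹' E : Set S)ᶜ) := by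
    have h1 : IsLocalHomeomorphOn g {z | z ∈ Ω ∧ g z ∉ E} := by
      refine IsLocalHomeomorphOn.mk _ _ ?_
      rintro z ⟨hz, hzE⟩
      have hd : deriv g z ≠ 0 := fun h => hzE (hcrit z hz h)
      have hs : HasStrictDerivAt g (deriv g z) z :=
        (hhol.analyticAt (hΩ.mem_nhds hz)).hasStrictDerivAt
      exact ⟨(hs.hasStrictFDerivAt_equiv hd).toOpenPartialHomeomorph g,
        (hs.hasStrictFDerivAt_equiv hd).mem_toOpenPartialHomeomorph_source, fun w _ => rfl⟩
    have h2 := h1.comp (f := (Subtype.val : Ω → ℂ)) (s := gW ⁻¹' (Subtype.val ⁻¹' E : Set S)ᶜ)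
      (hΩ.isOpenEmbedding_subtypeVal.isLocalHomeomorph.isLocalHomeomorphOn.mono (subset_univ _))
      (by
        intro w hw
        refine ⟨w.2, fun h => hw ?_⟩
        rw [mem_preimage, hgW]; exact h)
    have e : g ∘ (Subtype.val : Ω → ℂ) = Subtype.val ∘ gW := by
      funext w; simp [hgW]
    rw [e] at h2
    exact h2.of_comp_left
      (hS.isOpenEmbedding_subtypeVal.isLocalHomeomorph.isLocalHomeomorphOn.mono (subset_univ _))
      (fun w _ => gW.continuous.continuousAt)
  refine hprop.isClosedMap.isCoveringMapOn_of_isLocalHomeomorphOn (fun x hx => ?_) hl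
  refine (hp isCompact_singleton).finite (.of_openPartialHomeomorph gW subset_rfl ?_)
  intro e he
  obtain ⟨φ, h1, h2⟩ := hl e (by rw [mem_preimage] at he ⊢; rw [mem_singleton_iff] at he; rwa [he])
  exact ⟨φ, h1, h2.symm⟩

theorem conv_sc {V : Set ℂ} (hV : Convex ℝ V) (hne : V.Nonempty) : IsSimplyConnected V := by
  have := hV.contractibleSpace hne
  exact (inferInstance : SimplyConnectedSpace V)

theorem sub_sc {S V : Set ℂ} (hVS : V ⊆ S) (hV : IsSimplyConnected V) :
    IsSimplyConnected (Subtype.val ⁻¹' V : Set S) := by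
  rw [← Topology.IsEmbedding.subtypeVal.isSimplyConnected_image, Subtype.image_preimage_coe,
    inter_eq_right.2 hVS]
  exact hV

theorem sub_pc {S V : Set ℂ} (hVS : V ⊆ S) (hV : IsPathConnected V) :
    IsPathConnected (Subtype.val ⁻¹' V : Set S) := by
  rw [Topology.IsEmbedding.subtypeVal.isInducing.isPathConnected_iff, Subtype.image_preimage_coe,
    inter_eq_right.2 hVS]
  exact hV

theorem step_sc {a b : ℝ} (ha : a < -1) (hb : 1 < b) {S Ω : Set ℂ}
    (hS : ∀ z, z ∈ S ↔ z.im ≠ 0 ∨ (a < z.re ∧ z.re < b)) (hSo : IsOpen S)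
    [SimplyConnectedSpace S] [SimplyConnectedSpace Ω]
    (g : C(Ω, S)) {U II : Set ℂ} (hII : ∀ z, z ∈ II ↔ z.im = 0 ∧ -1 ≤ z.re ∧ z.re ≤ 1)
    (hIIc : IsCompact II)
    (cov : IsCoveringMapOn g (Subtype.val ⁻¹' II : Set S)ᶜ)
    (hUo : IsOpen U) (hUS : U ⊆ S) (hIU : II ⊆ U) (hsym : ∀ z ∈ U, (starRingEnd ℂ) z ∈ U)
    [SimplyConnectedSpace U] : IsSimplyConnected (g ⁻¹' (Subtype.val ⁻¹' U : Set S)) := by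
  have hSsym : ∀ z ∈ S, (starRingEnd ℂ) z ∈ S := by
    intro z hz; rw [hS] at hz ⊢; simpa using hz
  have haS : (a : ℂ) ∉ S := by rw [hS]; simp
  have hE : ∀ z ∈ II, z.im = 0 := fun z hz => ((hII z).1 hz).1
  have sA := half_sc hSo ⟨_, haS⟩ hSsym II hE
  have sB := half_sc' hSo ⟨_, haS⟩ hSsym II hE
  have sUA := half_sc hUo ⟨_, fun h => haS (hUS h)⟩ hsym II hE
  have sUB := half_sc' hUo ⟨_, fun h => haS (hUS h)⟩ hsym II hE
  obtain ⟨δ', hδ', hth⟩ := hIIc.exists_thickening_subset_open hUo hIU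
  let δ := δ' / 2
  have hδ : 0 < δ := by simp only [δ]; linarith
  have hδδ : δ < δ' := by simp only [δ]; linarith
  let p : ℂ → ℝ := fun w => max (-1) (min 1 w.re)
  have hpc : Continuous p := by simp only [p]; fun_prop
  have hpI : ∀ w, (p w : ℂ) ∈ II := by
    intro w; rw [hII]; simp [p]
  let ρ : ℂ → ℝ := fun w => ‖w - p w‖
  have hρc : Continuous ρ := by simp only [ρ]; fun_prop
  let k : ℂ → ℝ := fun w => δ / max δ (ρ w)
  have hmax : ∀ w, 0 < max δ (ρ w) := fun w => lt_max_of_lt_left hδ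
  have hkc : Continuous k := by
    simp only [k]
    exact Continuous.div (by fun_prop) (by fun_prop) (fun w => (hmax w).ne')
  have hk0 : ∀ w, 0 < k w := fun w => div_pos hδ (hmax w)
  have hk1 : ∀ w, k w ≤ 1 := fun w => (div_le_one (hmax w)).2 (le_max_left _ _)
  have hkρ : ∀ w, k w * ρ w ≤ δ := by
    intro w
    simp only [k]
    rw [div_mul_eq_mul_div, div_le_iff₀ (hmax w)]
    exact mul_le_mul_of_nonneg_left (le_max_right _ _) hδ.le
  let s : ℝ → ℂ → ℝ := fun t w => 1 - t + t * k w
  have hs0 : ∀ t ∈ Icc (0:ℝ) 1, ∀ w, 0 < s t w := by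
    intro t ht w
    simp only [s]
    rcases ht.1.eq_or_lt with h | h
    · rw [← h]; simp
    · have := mul_pos h (hk0 w); linarith [ht.2]
  have hs1 : ∀ t ∈ Icc (0:ℝ) 1, ∀ w, s t w ≤ 1 := by
    intro t ht w
    have := mul_le_mul_of_nonneg_left (hk1 w) ht.1
    simp only [s]; linarith
  let h : ℝ → ℂ → ℂ := fun t w => p w + (s t w : ℂ) * (w - p w)
  have him : ∀ t w, (h t w).im = s t w * w.im := by intro t w; simp [h]
  have hre : ∀ t w, (h t w).re = p w + s t w * (w.re - p w) := by intro t w; simp [h]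
  have hhc : Continuous (fun x : ℝ × ℂ => h x.1 x.2) := by
    simp only [h, s]; fun_prop
  have hN : ∀ t w, ρ w < δ → h t w = w := by
    intro t w hw
    have e : k w = 1 := by
      simp only [k]; rw [max_eq_left hw.le, div_self hδ.ne']
    simp [h, s, e]
  have hh0 : ∀ w, h 0 w = w := by intro w; simp [h, s]
  have hthU : ∀ w q : ℂ, q ∈ II → ‖w - q‖ < δ' → w ∈ U := by
    intro w q hq hw
    exact hth (Metric.mem_thickening_iff.2 ⟨q, hq, by rwa [dist_eq_norm]⟩)
  have hh1 : ∀ w, h 1 w ∈ U := by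
    intro w
    refine hthU _ (p w) (hpI w) ?_
    have : h 1 w - p w = (k w : ℂ) * (w - p w) := by simp [h, s]
    rw [this, norm_mul, Complex.norm_real, Real.norm_of_nonneg (hk0 w).le]
    exact (hkρ w).trans_lt hδδ
  -- the real case
  have hreal : ∀ t ∈ Icc (0:ℝ) 1, ∀ w : ℂ, w.im = 0 → w ∉ II →
      (1 < (h t w).re ∧ (h t w).re ≤ w.re) ∨ ((h t w).re < -1 ∧ w.re ≤ (h t w).re) := by
    intro t ht w hw hwI
    have h0 := hs0 t ht w
    have h1 := hs1 t ht w
    rw [hre]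
    by_cases hw1 : 1 < w.re
    · left
      have e : p w = 1 := by simp only [p]; rw [min_eq_left hw1.le]; norm_num
      rw [e]
      constructor <;> nlinarith
    · have hw2 : w.re < -1 := by
        by_contra hcon
        exact hwI ((hII w).2 ⟨hw, by linarith, by linarith⟩)
      right
      have e : p w = -1 := by
        simp only [p]; rw [min_eq_right (by linarith), max_eq_left hw2.le]
      rw [e]
      constructor <;> nlinarith
  have hhS : ∀ t ∈ Icc (0:ℝ) 1, ∀ w ∈ S, w ∉ II → h t w ∈ S ∧ h t w ∉ II := by
    intro t ht w hw hwI
    by_cases hi : w.im = 0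
    · have hw' := ((hS w).1 hw).resolve_left (by simpa using hi)
      have := hreal t ht w hi hwI
      rw [hS, hII]
      rcases this with ⟨h1, h2⟩ | ⟨h1, h2⟩
      · exact ⟨Or.inr ⟨by linarith, by linarith⟩, fun h => by linarith [h.2.2]⟩
      · exact ⟨Or.inr ⟨by linarith, by linarith⟩, fun h => by linarith [h.2.1]⟩
    · have : (h t w).im ≠ 0 := by
        rw [him]; exact mul_ne_zero (hs0 t ht w).ne' hi
      exact ⟨(hS _).2 (Or.inl this), fun h => this ((hII _).1 h).1⟩
  have hone : ((1:ℝ) : ℂ) ∈ U := hIU ((hII _).2 (by simp))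
  have hmone : ((-1:ℝ) : ℂ) ∈ U := hIU ((hII _).2 (by simp))
  have hhU : ∀ t ∈ Icc (0:ℝ) 1, ∀ w ∈ U, w.im = 0 → w ∉ II → h t w ∈ U := by
    intro t ht w hw hi hwI
    have hw' : ((w.re : ℝ) : ℂ) = w := Complex.ext (by simp) (by simp [hi])
    have hh' : (((h t w).re : ℝ) : ℂ) = h t w := Complex.ext (by simp) (by simp [him, hi])
    have hwr : ((w.re : ℝ) : ℂ) ∈ U := by rw [hw']; exact hw
    rw [← hh']
    rcases hreal t ht w hi hwI with ⟨h1, h2⟩ | ⟨h1, h2⟩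
    · rcases h2.eq_or_lt with h2 | h2
      · rw [h2]; exact hwr
      · exact real_slice hUo hsym hone hwr h1 h2
    · rcases h2.eq_or_lt with h2 | h2
      · rw [← h2]; exact hwr
      · exact real_slice hUo hsym hwr hmone h2 h1
  let K : Set S := Subtype.val ⁻¹' II
  let H : C(I × ↥(Kᶜ), ↥(Kᶜ)) :=
    ⟨fun x => ⟨⟨h x.1 x.2.1.1, (hhS x.1 x.1.2 _ x.2.1.2 x.2.2).1⟩,
      (hhS x.1 x.1.2 _ x.2.1.2 x.2.2).2⟩, by
      apply Continuous.subtype_mk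
      apply Continuous.subtype_mk
      exact hhc.comp (f := fun x : I × ↥(Kᶜ) => ((x.1 : ℝ), (x.2.1.1 : ℂ))) (by fun_prop)⟩
  have hHv : ∀ t w, ((H (t, w)).1 : ℂ) = h t w.1.1 := fun t w => rfl
  have imc : Continuous (fun w : S => (w : ℂ).im) := by fun_prop
  refine abs_sc g K (Subtype.val ⁻¹' U) (Subtype.val ⁻¹' {z | 0 ≤ z.im})
    (Subtype.val ⁻¹' {z | z.im ≤ 0}) (Subtype.val ⁻¹' {z | ρ z < δ}) cov
    (hIIc.isClosed.preimage continuous_subtype_val) (isClosed_le continuous_const imc)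
    (isClosed_le imc continuous_const) (fun x => le_total (0 : ℝ) (x : ℂ).im)
    ((isOpen_lt hρc continuous_const).preimage continuous_subtype_val) ?_ ?_ H ?_ ?_ ?_ ?_ ?_ ?_
    ?_ ?_ ?_ ?_ ?_
  · intro w hw
    have hw' := (hII _).1 hw
    have e : p w = (w : ℂ).re := by
      simp only [p]; rw [min_eq_right hw'.2.2, max_eq_right hw'.2.1]
    have e2 : (p w : ℂ) = w := by rw [e]; exact Complex.ext (by simp) (by simp [hw'.1])
    change ‖(w : ℂ) - p w‖ < δ
    rw [e2]; simpa using hδ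
  · intro w hw
    exact hthU _ _ (hpI w) (lt_trans hw hδδ)
  · intro w; apply Subtype.ext; apply Subtype.ext; rw [hHv]; exact hh0 _
  · intro t w hw; apply Subtype.ext; apply Subtype.ext; rw [hHv]; exact hN _ _ hw
  · intro w; exact hh1 _
  · intro t w hw
    have hw : 0 ≤ w.1.1.im := hw
    change 0 ≤ (h t w.1.1).im
    rw [him]
    exact mul_nonneg (hs0 t t.2 _).le hw
  · intro t w hw
    have hw : w.1.1.im ≤ 0 := hw
    change (h t w.1.1).im ≤ 0
    rw [him]
    exact mul_nonpos_of_nonneg_of_nonpos (hs0 t t.2 _).le hw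
  · intro t w hw hA hB
    exact hhU t t.2 _ hw (le_antisymm hB hA) w.2
  · convert sub_sc (S := S) (fun z hz => hz.1.1) sA using 1
    ext w; simp [K]
  · convert sub_sc (S := S) (fun z hz => hz.1.1) sB using 1
    ext w; simp [K]
  · exact sub_sc (S := S) (fun z hz => hUS hz.1.1) sUA
  · exact sub_sc (S := S) (fun z hz => hUS hz.1.1) sUB
  · intro x hx hA hB hxK
    have hA : 0 ≤ x.1.im := hA
    have hB : x.1.im ≤ 0 := hB
    obtain ⟨r, hr, hrU⟩ := Metric.isOpen_iff.1 (hUo.sdiff hIIc.isClosed) x.1 ⟨hx, hxK⟩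
    have hrS : Metric.ball x.1 r ⊆ S := fun z hz => hUS (hrU hz).1
    have cA : Convex ℝ {z : ℂ | 0 ≤ z.im} := convex_halfSpace_im_ge 0
    have cB : Convex ℝ {z : ℂ | z.im ≤ 0} := convex_halfSpace_im_le 0
    have cb := convex_ball x.1 r
    have hxb := Metric.mem_ball_self (x := x.1) hr
    refine ⟨Subtype.val ⁻¹' Metric.ball x.1 r, Metric.isOpen_ball.preimage continuous_subtype_val,
      hxb, fun w hw => hrU hw, sub_sc hrS (conv_sc cb ⟨_, hxb⟩), ?_, ?_⟩
    · exact sub_pc (inter_subset_left.trans hrS) ((cb.inter cA).isPathConnected ⟨_, hxb, hA⟩)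
    · exact sub_pc (inter_subset_left.trans hrS) ((cb.inter cB).isPathConnected ⟨_, hxb, hB⟩)

end Aux

/- STATEMENT 12 (Lemma 2.2, 1a): g : Ω → ℂ_J a proper holomorphic map of
degree d of a simply connected domain Ω onto the slit plane ℂ_J (J an open
interval containing [-1,1]), real on Ω ∩ ℝ, whose critical values (hence all
their forward iterates) lie in [-1,1] ⊆ J. Then the iterated preimages
P i = g⁻ⁱ(ℂ_J) form a decreasing sequence of connected, simply connected
open sets. -/
theorem iterated_preimages_connected_simply_connected
    (a b : ℝ) (J : Set ℝ) (hJ : J = Set.Ioo a b)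
    (hJI : Set.Icc (-1 : ℝ) 1 ⊆ J)
    (Ω : Set ℂ) (hΩopen : IsOpen Ω) (hΩconn : IsConnected Ω)
    (hΩsc : SimplyConnectedSpace ↥Ω)
    (hΩsub : Ω ⊆ slitC J)
    (g : ℂ → ℂ) (hhol : DifferentiableOn ℂ g Ω)
    (hmaps : Set.MapsTo g Ω (slitC J))
    (hsurj : Set.SurjOn g Ω (slitC J))
    (hproper : ∀ K : Set ℂ, K ⊆ slitC J → IsCompact K → IsCompact {z ∈ Ω | g z ∈ K})
    (d : ℕ) (hd : 2 ≤ d)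
    (hdeg : ∀ w ∈ slitC J, Set.ncard {z ∈ Ω | g z = w} ≤ d)
    (hreal : ∀ z ∈ Ω, z.im = 0 → (g z).im = 0)
    (hIΩ : (fun x : ℝ => (x : ℂ)) '' Set.Icc (-1 : ℝ) 1 ⊆ Ω)
    (hIinv : Set.MapsTo g ((fun x : ℝ => (x : ℂ)) '' Set.Icc (-1 : ℝ) 1)
      ((fun x : ℝ => (x : ℂ)) '' Set.Icc (-1 : ℝ) 1))
    (hcrit : ∀ z ∈ Ω, deriv g z = 0 → g z ∈ (fun x : ℝ => (x : ℂ)) '' Set.Icc (-1 : ℝ) 1)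
    (P : ℕ → Set ℂ) (hP0 : P 0 = slitC J)
    (hPs : ∀ i : ℕ, P (i + 1) = {z ∈ Ω | g z ∈ P i}) :
    (∀ i : ℕ, IsOpen (P i) ∧ IsConnected (P i) ∧ SimplyConnectedSpace ↥(P i)) ∧
    (∀ i : ℕ, P (i + 1) ⊆ P i) := by
  subst hJ
  have ha : a < -1 := (hJI (show (-1 : ℝ) ∈ Set.Icc (-1 : ℝ) 1 by simp)).1
  have hb : 1 < b := (hJI (show (1 : ℝ) ∈ Set.Icc (-1 : ℝ) 1 by simp)).2
  have hS : ∀ z, z ∈ slitC (Set.Ioo a b) ↔ z.im ≠ 0 ∨ (a < z.re ∧ z.re < b) := by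
    intro z
    constructor
    · rintro (h | ⟨x, hx, rfl⟩)
      · exact Or.inl h
      · exact Or.inr (by simpa using hx)
    · intro h
      by_cases hz : z.im = 0
      · exact Or.inr ⟨z.re, h.resolve_left (by simpa using hz), Complex.ext (by simp) (by simp [hz])⟩
      · exact Or.inl hz
  have hSo : IsOpen (slitC (Set.Ioo a b)) := by
    have e : slitC (Set.Ioo a b) = {z : ℂ | z.im ≠ 0} ∪ ({z : ℂ | a < z.re} ∩ {z : ℂ | z.re < b}) := by
      ext z; exact hS z
    rw [e]
    exact (isOpen_ne_fun Complex.continuous_im continuous_const).union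
      ((isOpen_lt continuous_const Complex.continuous_re).inter
        (isOpen_lt Complex.continuous_re continuous_const))
  have hSsym : ∀ z ∈ slitC (Set.Ioo a b), (starRingEnd ℂ) z ∈ slitC (Set.Ioo a b) := by
    intro z hz; rw [hS] at hz ⊢; simpa using hz
  have h0S : (0 : ℂ) ∈ slitC (Set.Ioo a b) := by
    rw [hS]; right; simp; constructor <;> linarith
  have hSsc : SimplyConnectedSpace ↥(slitC (Set.Ioo a b)) := by
    have hst : StarConvex ℝ (0 : ℂ) (slitC (Set.Ioo a b)) := by
      rw [starConvex_zero_iff]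
      intro z hz t ht0 ht1
      rw [hS] at hz ⊢
      rcases ht0.eq_or_lt with h | h
      · right; rw [← h]; simp; constructor <;> linarith
      · rcases hz with hz | ⟨h1, h2⟩
        · left; simpa using ⟨h.ne', hz⟩
        · right; simp; constructor <;> nlinarith
    have := hst.contractibleSpace ⟨_, h0S⟩
    infer_instance
  have h0I : (0 : ℂ) ∈ (fun x : ℝ => (x : ℂ)) '' Set.Icc (-1 : ℝ) 1 := mem_II.2 (by simp)
  have hcs := conj_sym hΩopen hΩconn.isPreconnected (hIΩ h0I) hSo hSsym g hhol hmaps hproper hreal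
  let gW : C(Ω, slitC (Set.Ioo a b)) := ⟨fun z => ⟨g z, hmaps z.2⟩,
    Continuous.subtype_mk (continuousOn_iff_continuous_domRestrict.1 hhol.continuousOn) _⟩
  have cov := cov_of_proper hΩopen hSo g hhol hproper hcrit gW (fun z => rfl)
  have main : ∀ i, IsOpen (P i) ∧ P i ⊆ slitC (Set.Ioo a b) ∧
      (fun x : ℝ => (x : ℂ)) '' Set.Icc (-1 : ℝ) 1 ⊆ P i ∧
      (∀ z ∈ P i, (starRingEnd ℂ) z ∈ P i) ∧ SimplyConnectedSpace ↥(P i) := by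
    intro i
    induction i with
    | zero =>
      rw [hP0]
      exact ⟨hSo, subset_rfl, hIΩ.trans hΩsub, hSsym, hSsc⟩
    | succ i ih =>
      obtain ⟨h1, h2, h3, h4, h5⟩ := ih
      have hsc := step_sc ha hb hS hSo gW (fun z => mem_II)
        (isCompact_Icc.image Complex.continuous_ofReal) cov h1 h2 h3 h4
      rw [← Topology.IsEmbedding.subtypeVal.isSimplyConnected_image] at hsc
      have e : Subtype.val '' (gW ⁻¹' (Subtype.val ⁻¹' P i)) = P (i + 1) := by
        rw [hPs]
        ext z
        constructor
        · rintro ⟨w, hw, rfl⟩; exact ⟨w.2, hw⟩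
        · rintro ⟨hz, hw⟩; exact ⟨⟨z, hz⟩, hw, rfl⟩
      rw [e] at hsc
      refine ⟨?_, ?_, ?_, ?_, hsc⟩
      · rw [hPs]; exact hhol.continuousOn.isOpen_inter_preimage hΩopen h1
      · rw [hPs]; exact fun z hz => hΩsub hz.1
      · rw [hPs]; exact fun z hz => ⟨hIΩ hz, h3 (hIinv hz)⟩
      · rw [hPs]
        rintro z ⟨hz, hgz⟩
        obtain ⟨c1, c2⟩ := hcs z hz
        exact ⟨c1, by rw [c2]; exact h4 _ hgz⟩
  refine ⟨fun i => ?_, fun i => ?_⟩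
  · obtain ⟨h1, -, -, -, h5⟩ := main i
    have h6 : IsSimplyConnected (P i) := h5
    exact ⟨h1, h6.isPathConnected.isConnected, h5⟩
  · induction i with
    | zero => rw [hP0]; exact (main 1).2.1
    | succ i ih =>
      rw [hPs (i + 1)]
      intro z hz
      rw [hPs i]
      exact ⟨hz.1, ih hz.2⟩
end
end

section
/- Let Q(z) = z² and let g = F ∘ Q, where J ⊆ ℝ is an open symmetric interval containing [-1,1] and F⁻¹ : ℂ_J → ℂ is a univalent (injective holomorphic) map, and suppose the critical value g(0) = F(0) lies in ℂ_J. Then Ω := Q⁻¹(F⁻¹(ℂ_J)) is a connected, simply connected open subset of ℂ. -/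
noncomputable section

open Filter Topology Set in
lemma aux_deriv_ne_zero {G : ℂ → ℂ} {v : ℂ} {D : Set ℂ} (hD : D ∈ 𝓝 v)
    (hG : AnalyticAt ℂ G v) (hinj : Set.InjOn G D) (h0 : G v = 0) : deriv G v ≠ 0 := by
  have hfin : analyticOrderAt G v ≠ ⊤ := by
    intro h
    rw [analyticOrderAt_eq_top] at h
    have h1 : ∀ᶠ z in 𝓝[≠] v, G z = 0 ∧ z ∈ D := (h.and hD).filter_mono nhdsWithin_le_nhds
    obtain ⟨z, ⟨hz, hzD⟩, hzv⟩ := (h1.and self_mem_nhdsWithin).exists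
    exact hzv (hinj hzD (mem_of_mem_nhds hD) (hz.trans h0.symm))
  obtain ⟨n, hn⟩ := ENat.ne_top_iff_exists.1 hfin
  obtain ⟨g, hg, hgv, hGg⟩ := (hG.analyticOrderAt_eq_natCast).1 hn.symm
  have hn0 : n ≠ 0 := by
    rintro rfl
    have := hGg.self_of_nhds
    rw [h0] at this
    simp at this
    exact hgv this.symm
  have hnC : (n : ℂ) ≠ 0 := by exact_mod_cast hn0
  -- local nth root
  set c : ℂ := Complex.exp (Complex.log (g v) / n) with hc
  have hcn : c ^ n = g v := by
    rw [hc, ← Complex.exp_nat_mul, mul_div_cancel₀ _ hnC, Complex.exp_log hgv]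
  set r : ℂ → ℂ := fun z => c * Complex.exp (Complex.log (g z / g v) / n) with hr
  have hquot : AnalyticAt ℂ (fun z => g z / g v) v := hg.fun_div analyticAt_const hgv
  have hq1 : g v / g v = 1 := div_self hgv
  have hra : AnalyticAt ℂ r v := by
    apply analyticAt_const.mul
    apply AnalyticAt.cexp
    apply AnalyticAt.fun_div _ analyticAt_const hnC
    apply hquot.clog
    simp [hq1]
  have hrv : r v = c := by simp [hr, hq1]
  have hc0 : c ≠ 0 := Complex.exp_ne_zero _
  have hrn : ∀ᶠ z in 𝓝 v, r z ^ n = g z := by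
    filter_upwards [hg.continuousAt.eventually_ne hgv] with z hz
    simp only [hr]
    rw [mul_pow, hcn, ← Complex.exp_nat_mul, mul_div_cancel₀ _ hnC,
      Complex.exp_log (div_ne_zero hz hgv), mul_div_cancel₀ _ hgv]
  set K : ℂ → ℂ := fun z => (z - v) * r z with hK
  have hKa : AnalyticAt ℂ K v := (analyticAt_id.sub analyticAt_const).mul hra
  have hKd : HasStrictDerivAt K c v := by
    have h1 := HasStrictDerivAt.fun_mul ((hasStrictDerivAt_id v).sub_const v) hra.hasStrictDerivAt
    simpa [hrv] using h1
  have hGK : ∀ᶠ z in 𝓝 v, G z = K z ^ n := by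
    filter_upwards [hGg, hrn] with z h1 h2
    rw [h1, hK, mul_pow, h2, smul_eq_mul]
  have hKv : K v = 0 := by simp [hK]
  have hmap : map K (𝓝 v) = 𝓝 0 := by rw [hKd.map_nhds_eq hc0, hKv]
  have hS : K '' {z | z ∈ D ∧ G z = K z ^ n} ∈ 𝓝 (0 : ℂ) := by
    rw [← hmap]
    exact image_mem_map (inter_mem hD hGK)
  by_cases hn1 : n = 1
  · have : deriv G v = deriv K v := by
      apply EventuallyEq.deriv_eq
      filter_upwards [hGK] with z hz
      rw [hz, hn1, pow_one]
    rw [this, hKd.hasDerivAt.deriv]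
    exact hc0
  · exfalso
    have hω := Complex.isPrimitiveRoot_exp n hn0
    set ω := Complex.exp (2 * Real.pi * Complex.I / n)
    have hω1 : ω ≠ 1 := hω.ne_one (by omega)
    have htend : Tendsto (fun z : ℂ => ω * z) (𝓝 0) (𝓝 0) := by
      have : Continuous (fun z : ℂ => ω * z) := by fun_prop
      simpa using this.tendsto 0
    have h1 : ∀ᶠ z in 𝓝[≠] (0 : ℂ), z ∈ K '' {z | z ∈ D ∧ G z = K z ^ n} ∧
        ω * z ∈ K '' {z | z ∈ D ∧ G z = K z ^ n} :=
      (Eventually.and hS (htend hS)).filter_mono nhdsWithin_le_nhds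
    obtain ⟨e, ⟨⟨x, ⟨hxD, hx⟩, hxe⟩, ⟨y, ⟨hyD, hy⟩, hye⟩⟩, he⟩ :=
      (h1.and self_mem_nhdsWithin).exists
    have hxy : x = y := by
      apply hinj hxD hyD
      rw [hx, hy, hxe, hye, mul_pow, hω.pow_eq_one, one_mul]
    rw [hxy, hye] at hxe
    exact hω1 (mul_right_cancel₀ (b := e) he (by rw [hxe, one_mul]))

open Filter Topology Set in
lemma aux_sqrt_diff {s k : ℂ → ℂ} {D : Set ℂ} (hD : IsOpen D) (hs : ContinuousOn s D)
    (hk : DifferentiableOn ℂ k D) (hsk : ∀ z, s z ^ 2 = k z) (hk0 : ∀ z ∈ D, k z ≠ 0) :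
    DifferentiableOn ℂ s D := by
  intro z hz
  apply DifferentiableAt.differentiableWithinAt
  have hsz : s z ≠ 0 := by
    intro h
    apply hk0 z hz
    rw [← hsk z, h]; simp
  have hsc := hs.continuousAt (hD.mem_nhds hz)
  have hkd := (hk.differentiableAt (hD.mem_nhds hz)).hasDerivAt
  suffices h : HasDerivAt s (deriv k z * (s z + s z)⁻¹) z from h.differentiableAt
  rw [hasDerivAt_iff_tendsto_slope] at hkd ⊢
  have hne : s z + s z ≠ 0 := by
    rw [← two_mul]; exact mul_ne_zero two_ne_zero hsz
  have hadd : ContinuousAt (fun w => s w + s z) z := hsc.add continuousAt_const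
  have h1 : Tendsto (fun w => (s w + s z)⁻¹) (𝓝[≠] z) (𝓝 (s z + s z)⁻¹) :=
    ((hadd.tendsto).inv₀ hne).mono_left nhdsWithin_le_nhds
  refine (hkd.mul h1).congr' ?_
  filter_upwards [(hadd.eventually_ne hne).filter_mono nhdsWithin_le_nhds] with w hw
  simp only [slope, vsub_eq_sub, smul_eq_mul]
  rw [← hsk w, ← hsk z]
  field_simp
  ring

/-- The square-root transform of a univalent function on the disc. -/
lemma aux_main {G : ℂ → ℂ} (hG : DifferentiableOn ℂ G (Metric.ball 0 1))
    (hinj : Set.InjOn G (Metric.ball 0 1)) {v : ℂ} (hv : v ∈ Metric.ball (0 : ℂ) 1)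
    (h0 : G v = 0) :
    IsOpen {z : ℂ | z ^ 2 ∈ G '' Metric.ball 0 1} ∧
    IsConnected {z : ℂ | z ^ 2 ∈ G '' Metric.ball 0 1} ∧
    SimplyConnectedSpace ↥{z : ℂ | z ^ 2 ∈ G '' Metric.ball 0 1} := by
  set D : Set ℂ := Metric.ball 0 1 with hDdef
  have hDo : IsOpen D := Metric.isOpen_ball
  have hDc : Convex ℝ D := convex_ball 0 1
  have hDn := hDo.mem_nhds hv
  have hd := aux_deriv_ne_zero hDn (hG.analyticAt hDn) hinj h0
  set k := dslope G v with hkdef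
  have hk : DifferentiableOn ℂ k D := (Complex.differentiableOn_dslope hDn).2 hG
  have hGk : ∀ z, G z = (z - v) * k z := by
    intro z
    have := sub_smul_dslope G v z
    rw [h0, sub_zero, smul_eq_mul] at this
    exact this.symm
  have hk0 : ∀ z ∈ D, k z ≠ 0 := by
    intro z hz h
    by_cases hzv : z = v
    · rw [hzv, hkdef, dslope_same] at h
      exact hd h
    · apply hzv
      apply hinj hz hv
      rw [h0, hGk, h, mul_zero]
  have hDs : IsSimplyConnected D := by
    have : ContractibleSpace D := hDc.contractibleSpace ⟨v, hv⟩
    exact SimplyConnectedSpace.ofContractible D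
  obtain ⟨s, hsc, hs⟩ := Complex.exists_continuousOn_pow_eq hDs hDo hk.continuousOn
    (by rintro ⟨z, hz, h⟩; exact hk0 z hz h) two_ne_zero
  have hsd := aux_sqrt_diff hDo hsc hk hs hk0
  set W : Set ℂ := {z | z ^ 2 + v ∈ D} with hW
  set H : ℂ → ℂ := fun z => z * s (z ^ 2 + v) with hH
  have hWo : IsOpen W := hDo.preimage (by fun_prop : Continuous fun z : ℂ => z ^ 2 + v)
  have hHd : DifferentiableOn ℂ H W := by
    apply differentiableOn_id.mul
    apply hsd.comp (t := D) (by fun_prop)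
    intro z hz
    exact hz
  have hW0 : (0 : ℂ) ∈ W := by simpa [hW] using hv
  have hWstar : StarConvex ℝ 0 W := by
    rw [starConvex_zero_iff]
    intro z hz t ht0 ht1
    have := hDc hz hv (sq_nonneg t) (by nlinarith : (0 : ℝ) ≤ 1 - t ^ 2) (by ring)
    change (t • z) ^ 2 + v ∈ D
    have he : (t • z) ^ 2 + v = t ^ 2 • (z ^ 2 + v) + (1 - t ^ 2) • v := by
      simp only [Complex.real_smul]
      push_cast
      ring
    rw [he]
    exact this
  have hWcontr : ContractibleSpace W := hWstar.contractibleSpace ⟨0, hW0⟩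
  have hWconn : IsConnected W := by
    rw [isConnected_iff_connectedSpace]
    infer_instance
  have hHG : ∀ z, H z ^ 2 = G (z ^ 2 + v) := by
    intro z
    rw [hGk, hH, mul_pow, hs]
    ring
  have hodd : ∀ z, H (-z) = - H z := by
    intro z; simp [hH]
  have hHinj : Set.InjOn H W := by
    intro z hz w hw h
    have h1 : z ^ 2 + v = w ^ 2 + v := by
      apply hinj hz hw
      rw [← hHG, ← hHG, h]
    have h2 : z ^ 2 = w ^ 2 := by linear_combination h1
    rcases sq_eq_sq_iff_eq_or_eq_neg.1 h2 with h3 | h3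
    · exact h3
    · rw [h3, hodd] at h
      have h4 : H w = 0 := by linear_combination (-1 / 2 : ℂ) * h
      rcases mul_eq_zero.1 h4 with h5 | h5
      · rw [h3, h5, neg_zero]
      · exfalso
        apply hk0 _ hw
        rw [← hs, h5]; simp
  have himg : {z : ℂ | z ^ 2 ∈ G '' D} = H '' W := by
    ext w
    constructor
    · rintro ⟨x, hx, hxw⟩
      obtain ⟨z, hz⟩ := IsAlgClosed.exists_pow_nat_eq (x - v) (n := 2) (by norm_num)
      have hzx : z ^ 2 + v = x := by rw [hz]; ring
      have hzW : z ∈ W := by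
        change z ^ 2 + v ∈ D
        rwa [hzx]
      have h1 : w ^ 2 = H z ^ 2 := by rw [hHG, hzx, hxw]
      rcases sq_eq_sq_iff_eq_or_eq_neg.1 h1 with h3 | h3
      · exact ⟨z, hzW, h3.symm⟩
      · refine ⟨-z, ?_, by rw [hodd, h3]⟩
        change (-z) ^ 2 + v ∈ D
        rwa [neg_sq]
    · rintro ⟨z, hz, rfl⟩
      exact ⟨z ^ 2 + v, hz, (hHG z).symm⟩
  have hopen : ∀ t ⊆ W, IsOpen t → IsOpen (H '' t) := by
    rcases (hHd.analyticOnNhd hWo).is_constant_or_isOpen hWconn.isPreconnected with h | h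
    · exfalso
      obtain ⟨w, hw⟩ := h
      have hn : ∀ᶠ z in nhdsWithin (0 : ℂ) {0}ᶜ, z ∈ W :=
        nhdsWithin_le_nhds (hWo.mem_nhds hW0)
      obtain ⟨z, hz, hz0⟩ := (hn.and self_mem_nhdsWithin).exists
      exact hz0 (hHinj hz hW0 ((hw z hz).trans (hw 0 hW0).symm))
    · exact h
  have hemb : Topology.IsOpenEmbedding (fun z : W => H z) := by
    apply Topology.IsOpenEmbedding.of_continuous_injective_isOpenMap
    · exact continuousOn_iff_continuous_domRestrict.1 hHd.continuousOn
    · intro x y h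
      exact Subtype.ext (hHinj x.2 y.2 h)
    · intro t ht
      have := hopen (Subtype.val '' t) (by rintro _ ⟨x, _, rfl⟩; exact x.2)
        (hWo.isOpenMap_subtype_val t ht)
      rwa [Set.image_image] at this
  rw [himg]
  refine ⟨hopen W subset_rfl hWo, hWconn.image H hHd.continuousOn, ?_⟩
  have h1 : H '' W = (fun z : W => H z) '' Set.univ := by
    ext w; simp
  rw [h1]
  have h2 := (hemb.isEmbedding.isSimplyConnected_image (s := Set.univ)).2
    ((Homeomorph.Set.univ W).toHomotopyEquiv.simplyConnectedSpace_iff.2 inferInstance)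
  exact h2

/-- Uniformization of the slit plane. -/
lemma aux_unif (a : ℝ) (ha : 0 < a) :
    ∃ φ : ℂ → ℂ, DifferentiableOn ℂ φ (Metric.ball 0 1) ∧ Set.InjOn φ (Metric.ball 0 1) ∧
      φ '' Metric.ball 0 1 = slitC (Set.Ioo (-a) a) := by
  have haC : (a : ℂ) ≠ 0 := by exact_mod_cast ha.ne'
  have hne : ∀ z ∈ Metric.ball (0 : ℂ) 1, 1 + z ^ 2 ≠ 0 := by
    intro z hz h
    rw [mem_ball_zero_iff] at hz
    have h1 : z ^ 2 = -1 := by linear_combination h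
    have h2 : ‖z‖ ^ 2 = 1 := by rw [← norm_pow, h1]; simp
    nlinarith [norm_nonneg z]
  have hmem : ∀ w : ℂ, w ∈ slitC (Set.Ioo (-a) a) ↔ (w.im ≠ 0 ∨ w.re ^ 2 < a ^ 2) := by
    intro w
    simp only [slitC, Set.mem_union, Set.mem_ofPred_eq, Set.mem_image]
    constructor
    · rintro (h | ⟨x, hx, rfl⟩)
      · exact Or.inl h
      · right
        simpa using sq_lt_sq' hx.1 hx.2
    · rintro (h | h)
      · exact Or.inl h
      · by_cases him : w.im = 0
        · right
          refine ⟨w.re, abs_lt.1 (abs_lt_of_sq_lt_sq h ha.le), ?_⟩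
          apply Complex.ext <;> simp [him]
        · exact Or.inl him
  refine ⟨fun z => 2 * a * z / (1 + z ^ 2), ?_, ?_, ?_⟩
  · intro z hz
    apply DifferentiableAt.differentiableWithinAt
    have := hne z hz
    fun_prop (disch := assumption)
  · intro z hz w hw h
    have h1 := hne z hz
    have h2 := hne w hw
    simp only at h
    rw [div_eq_div_iff h1 h2] at h
    have h3 : (2 * a : ℂ) * ((z - w) * (1 - z * w)) = 0 := by linear_combination h
    rcases mul_eq_zero.1 h3 with h4 | h4
    · exact absurd h4 (mul_ne_zero two_ne_zero haC)
    · rcases mul_eq_zero.1 h4 with h5 | h5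
      · exact sub_eq_zero.1 h5
      · exfalso
        rw [mem_ball_zero_iff] at hz hw
        have h6 : z * w = 1 := by linear_combination -h5
        have h7 : ‖z‖ * ‖w‖ = 1 := by rw [← norm_mul, h6, norm_one]
        nlinarith [norm_nonneg z, norm_nonneg w]
  · ext w
    rw [hmem]
    constructor
    · rintro ⟨z, hz, rfl⟩
      have h1 := hne z hz
      by_contra! hcon
      set w : ℂ := 2 * a * z / (1 + z ^ 2) with hw
      obtain ⟨him, hre⟩ := hcon
      have hweq : w * (1 + z ^ 2) = 2 * a * z := div_mul_cancel₀ _ h1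
      have hr := congrArg Complex.re hweq
      have hi := congrArg Complex.im hweq
      simp [pow_two, him] at hr hi
      rw [mem_ball_zero_iff, Complex.norm_def, Real.sqrt_lt' one_pos, Complex.normSq_apply] at hz
      set r := w.re
      set x := z.re
      set y := z.im
      -- r (1 + x² - y²) = 2 a x ; r (2xy) = 2 a y
      have hr0 : r ≠ 0 := by
        intro h
        rw [h] at hre
        nlinarith
      by_cases hy : y = 0
      · rw [hy] at hr hz
        have e1 : (r * (1 + x * x)) ^ 2 = 4 * a ^ 2 * x ^ 2 := by
          have : r * (1 + x * x) = 2 * a * x := by linarith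
          rw [this]; ring
        have e2 : a ^ 2 * (1 + x * x) ^ 2 ≤ (r * (1 + x * x)) ^ 2 := by
          rw [mul_pow]
          exact mul_le_mul_of_nonneg_right hre (sq_nonneg _)
        have e3 : 0 < a ^ 2 * (1 - x * x) ^ 2 := by
          apply mul_pos (by positivity)
          apply pow_pos; nlinarith
        nlinarith
      · have e1 : r * x = a := by
          apply mul_right_cancel₀ hy
          linarith
        have e2 : r * (1 - x * x - y * y) = 0 := by
          have : a * x = r * x * x := by rw [e1]
          nlinarith
        rcases mul_eq_zero.1 e2 with h | h
        · exact hr0 h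
        · linarith
    · intro hw
      by_cases hw0 : w = 0
      · exact ⟨0, by simp, by simp [hw0]⟩
      obtain ⟨d, hd⟩ := IsAlgClosed.exists_pow_nat_eq ((a / w) ^ 2 - 1 : ℂ) (n := 2) (by norm_num)
      have key : ∀ z z' : ℂ, z * z' = 1 → z + z' = 2 * (a / w) → ‖z‖ ≤ 1 →
          ∃ z ∈ Metric.ball (0 : ℂ) 1, 2 * a * z / (1 + z ^ 2) = w := by
        intro z z' hmul hadd hz
        have hq : w * (1 + z ^ 2) = 2 * a * z := by
          have h1 : 1 + z ^ 2 = 2 * (a / w) * z := by rw [← hadd, ← hmul]; ring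
          rw [h1]; field_simp
        have hzlt : ‖z‖ < 1 := by
          refine lt_of_le_of_ne hz fun hz1 => ?_
          have hz' : z' = (starRingEnd ℂ) z := by
            have hz0 : z ≠ 0 := by rintro rfl; simp at hz1
            apply mul_left_cancel₀ hz0
            rw [hmul, Complex.mul_conj, Complex.normSq_eq_norm_sq, hz1]; simp
          rw [hz', Complex.add_conj] at hadd
          have h3 : (z.re : ℂ) * w = a := by
            push_cast at hadd
            field_simp at hadd
            linear_combination hadd
          have hr := congrArg Complex.re h3
          have hi := congrArg Complex.im h3
          simp at hr hi
          have hx0 : z.re ≠ 0 := by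
            intro h; rw [h] at hr; simp at hr; exact ha.ne hr
          have him : w.im = 0 := hi.resolve_left hx0
          rcases hw with h | h
          · exact h him
          · have hx : z.re ^ 2 ≤ 1 := by
              have := Complex.abs_re_le_norm z
              rw [hz1] at this
              exact (sq_le_one_iff_abs_le_one _).2 this
            have : a ^ 2 = z.re ^ 2 * w.re ^ 2 := by rw [← hr]; ring
            nlinarith [sq_nonneg w.re]
        have hzb : z ∈ Metric.ball (0 : ℂ) 1 := by rwa [mem_ball_zero_iff]
        refine ⟨z, hzb, ?_⟩
        rw [← hq, mul_div_cancel_right₀ _ (hne z hzb)]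
      have hm : (a / w + d) * (a / w - d) = 1 := by linear_combination -hd
      rcases le_total ‖(a / w + d : ℂ)‖ 1 with h | h
      · exact key _ _ hm (by ring) h
      · refine key (a / w - d) (a / w + d) (by rw [mul_comm, hm]) (by ring) ?_
        have h7 : ‖(a / w + d : ℂ)‖ * ‖(a / w - d : ℂ)‖ = 1 := by
          rw [← norm_mul, hm, norm_one]
        nlinarith [norm_nonneg (a / w - d : ℂ)]

/- STATEMENT 13: let g = F ∘ Q with Q(z) = z², where F⁻¹ = Finv is univalent on
the slit plane ℂ_J, J a symmetric open interval containing [-1,1]. If the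
critical value g(0) = F(0) lies in ℂ_J — equivalently 0 ∈ Finv(ℂ_J) — then
Ω = Q⁻¹(Finv(ℂ_J)) is a connected, simply connected open subset of ℂ. -/
theorem domain_connected_simply_connected
    (a : ℝ) (ha : 1 < a) (J : Set ℝ) (hJ : J = Set.Ioo (-a) a)
    (Finv : ℂ → ℂ)
    (hhol : DifferentiableOn ℂ Finv (slitC J))
    (hinj : Set.InjOn Finv (slitC J))
    (h0 : (0 : ℂ) ∈ Finv '' slitC J) :
    IsOpen {z : ℂ | z ^ 2 ∈ Finv '' slitC J} ∧
    IsConnected {z : ℂ | z ^ 2 ∈ Finv '' slitC J} ∧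
    SimplyConnectedSpace ↥{z : ℂ | z ^ 2 ∈ Finv '' slitC J} := by
  subst hJ
  obtain ⟨φ, hφd, hφi, hφ⟩ := aux_unif a (by linarith)
  have hmaps : Set.MapsTo φ (Metric.ball 0 1) (slitC (Set.Ioo (-a) a)) := by
    rw [← hφ]; exact Set.mapsTo_image _ _
  have himg : Finv '' slitC (Set.Ioo (-a) a) = (Finv ∘ φ) '' Metric.ball 0 1 := by
    rw [Set.image_comp, hφ]
  rw [himg] at h0 ⊢
  obtain ⟨v, hv, hv0⟩ := h0
  exact aux_main (hhol.comp hφd hmaps) (hinj.comp hφi hmaps) hv hv0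
end
end

section
/- Let D ⊆ ℂ be a simply connected open set and Q(z) = z². If 0 ∈ D, then Q⁻¹(D) is connected and simply connected. -/
open Function Filter Metric Set
open scoped Topology ComplexConjugate

theorem rm_sqrt {U : Set ℂ} (hUo : IsOpen U) (hUc : IsSimplyConnected U) {g : ℂ → ℂ}
    (hg : DifferentiableOn ℂ g U) (h0 : ∀ z ∈ U, g z ≠ 0) :
    ∃ f : ℂ → ℂ, DifferentiableOn ℂ f U ∧ ∀ z, f z ^ 2 = g z := by
  obtain ⟨f, hfc, hf⟩ := Complex.exists_continuousOn_pow_eq hUc hUo hg.continuousOn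
    (by rintro ⟨z, hz, h⟩; exact h0 z hz h) two_ne_zero
  refine ⟨f, fun z hz ↦ DifferentiableAt.differentiableWithinAt ?_, hf⟩
  have hfz : f z ≠ 0 := by
    intro h; apply h0 z hz; rw [← hf, h]; simp
  have hca : ContinuousAt f z := hfc.continuousAt (hUo.mem_nhds hz)
  have hgd := (hg.differentiableAt (hUo.mem_nhds hz)).hasDerivAt
  have hsum : Tendsto (fun w ↦ f w + f z) (𝓝 z) (𝓝 (f z + f z)) := hca.tendsto.add_const _
  have hne : f z + f z ≠ 0 := by rw [← two_mul]; simpa using hfz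
  refine HasDerivAt.differentiableAt (f' := deriv g z / (f z + f z)) ?_
  rw [hasDerivAt_iff_tendsto_slope] at hgd ⊢
  refine (hgd.div (hsum.mono_left nhdsWithin_le_nhds) hne).congr' ?_
  filter_upwards [(hsum.eventually_ne hne).filter_mono nhdsWithin_le_nhds,
    self_mem_nhdsWithin] with w hw hwz
  have : w - z ≠ 0 := sub_ne_zero.mpr hwz
  simp only [slope_def_field, Pi.div_apply]
  rw [← hf w, ← hf z]
  field_simp
  ring

/-- The Moebius automorphism of the disk. -/
noncomputable def rmMob (a z : ℂ) : ℂ := (z - a) / (1 - conj a * z)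

theorem rmMob_den {a z : ℂ} (ha : ‖a‖ < 1) (hz : ‖z‖ < 1) : 1 - conj a * z ≠ 0 := by
  intro h
  have h1 : conj a * z = 1 := (sub_eq_zero.mp h).symm
  have h2 : ‖a‖ * ‖z‖ = 1 := by
    have := congrArg norm h1
    simpa using this
  nlinarith [norm_nonneg a, norm_nonneg z]

theorem rmMob_norm {a z : ℂ} (ha : ‖a‖ < 1) (hz : ‖z‖ < 1) : ‖rmMob a z‖ < 1 := by
  have hd := rmMob_den ha hz
  unfold rmMob
  rw [norm_div, div_lt_one (norm_pos_iff.mpr hd)]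
  have key : ‖1 - conj a * z‖ ^ 2 - ‖z - a‖ ^ 2 = (1 - ‖a‖ ^ 2) * (1 - ‖z‖ ^ 2) := by
    simp only [← Complex.normSq_eq_norm_sq, Complex.normSq_apply]
    simp
    ring
  have : 0 < (1 - ‖a‖ ^ 2) * (1 - ‖z‖ ^ 2) := by
    apply mul_pos <;> nlinarith [norm_nonneg a, norm_nonneg z]
  exact lt_of_pow_lt_pow_left₀ 2 (norm_nonneg _) (by linarith)

theorem rmMob_inj {a z w : ℂ} (ha : ‖a‖ < 1) (hz : ‖z‖ < 1) (hw : ‖w‖ < 1)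
    (h : rmMob a z = rmMob a w) : z = w := by
  have h1 := rmMob_den ha hz
  have h2 := rmMob_den ha hw
  have h3 := rmMob_den ha ha
  unfold rmMob at h
  rw [div_eq_div_iff h1 h2] at h
  have : (1 - conj a * a) * (z - w) = 0 := by linear_combination h
  rcases mul_eq_zero.mp this with h | h
  · exact absurd h h3
  · exact sub_eq_zero.mp h

theorem rmMob_hasDerivAt {a z : ℂ} (ha : ‖a‖ < 1) (hz : ‖z‖ < 1) :
    HasDerivAt (rmMob a) ((1 - conj a * a) / (1 - conj a * z) ^ 2) z := by
  have h1 := rmMob_den ha hz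
  have := ((hasDerivAt_id z).sub_const a).div
    (((hasDerivAt_id z).const_mul (conj a)).const_sub 1) h1
  refine this.congr_deriv ?_
  simp
  ring

theorem rmMob_self (a : ℂ) : rmMob a a = 0 := by simp [rmMob]

theorem rmMob_ne {a z : ℂ} (ha : ‖a‖ < 1) (hz : ‖z‖ < 1) (h : z ≠ a) : rmMob a z ≠ 0 :=
  div_ne_zero (sub_ne_zero.mpr h) (rmMob_den ha hz)

structure RmFam (U : Set ℂ) (f : ℂ → ℂ) : Prop where
  diff : DifferentiableOn ℂ f U
  inj : InjOn f U
  maps : ∀ z ∈ U, ‖f z‖ < 1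
  zero : f 0 = 0

/-- Post-composition with a Moebius map normalises a map into the disk. -/
theorem RmFam.of_mob {U : Set ℂ} {f : ℂ → ℂ} (hUo : IsOpen U) (h0 : (0 : ℂ) ∈ U)
    (hd : DifferentiableOn ℂ f U) (hi : InjOn f U) (hm : ∀ z ∈ U, ‖f z‖ < 1) :
    RmFam U (rmMob (f 0) ∘ f) ∧
      deriv (rmMob (f 0) ∘ f) 0 = deriv f 0 / (1 - conj (f 0) * f 0) := by
  refine ⟨⟨?_, ?_, ?_, ?_⟩, ?_⟩
  · intro z hz
    exact ((rmMob_hasDerivAt (hm 0 h0) (hm z hz)).differentiableAt).comp_differentiableWithinAt z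
      (hd z hz)
  · intro z hz w hw h
    exact hi hz hw (rmMob_inj (hm 0 h0) (hm z hz) (hm w hw) h)
  · intro z hz
    exact rmMob_norm (hm 0 h0) (hm z hz)
  · exact rmMob_self _
  · have h1 := rmMob_hasDerivAt (hm 0 h0) (hm 0 h0)
    have h2 := (hd.differentiableAt (hUo.mem_nhds h0)).hasDerivAt
    rw [(h1.comp 0 h2).deriv]
    have := rmMob_den (hm 0 h0) (hm 0 h0)
    field_simp

theorem rm_nonempty {U : Set ℂ} (hUo : IsOpen U) (hUc : IsSimplyConnected U) (h0 : (0 : ℂ) ∈ U)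
    (hU : U ≠ univ) : ∃ f, RmFam U f ∧ deriv f 0 ≠ 0 := by
  obtain ⟨a, ha⟩ := (ne_univ_iff_exists_notMem U).mp hU
  obtain ⟨f, hfd, hf⟩ := rm_sqrt hUo hUc (g := fun z ↦ z - a) (by fun_prop)
    (fun z hz h ↦ ha (by rwa [← sub_eq_zero.mp h]))
  have hf0 : ∀ z ∈ U, f z ≠ 0 := by
    intro z hz h
    have := hf z
    rw [h] at this
    apply ha
    have h2 : z = a := by linear_combination -this
    rwa [← h2]
  have hdf : ∀ z ∈ U, 2 * f z * deriv f z = 1 := by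
    intro z hz
    have h1 := (hfd.differentiableAt (hUo.mem_nhds hz)).hasDerivAt
    have h2 := h1.pow 2
    have h3 : HasDerivAt (f ^ 2) 1 z := by
      have : f ^ 2 = fun z ↦ z - a := by ext z; simpa using hf z
      rw [this]; exact (hasDerivAt_id z).sub_const a
    have := h2.unique h3
    simpa using this
  have hnc : ¬ ∃ w, ∀ z ∈ U, f z = w := by
    rintro ⟨w, hw⟩
    have : deriv f 0 = 0 := by
      have : f =ᶠ[𝓝 0] fun _ ↦ w := by
        filter_upwards [hUo.mem_nhds h0] with z hz using hw z hz
      rw [this.deriv_eq]; simp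
    have h := hdf 0 h0
    rw [this] at h; simp at h
  have hopen : IsOpen (f '' U) := by
    rcases (hfd.analyticOnNhd hUo).is_constant_or_isOpen
      hUc.isPathConnected.isConnected.isPreconnected with h | h
    · exact absurd h hnc
    · exact h U subset_rfl hUo
  obtain ⟨ε, hε, hball⟩ := Metric.isOpen_iff.mp hopen (f 0) ⟨0, h0, rfl⟩
  have hfar : ∀ z ∈ U, ε ≤ ‖f z + f 0‖ := by
    intro z hz
    by_contra! hlt
    have : -f z ∈ ball (f 0) ε := by
      have e : -(-f z - f 0) = f z + f 0 := by ring
      rw [mem_ball, dist_eq_norm, ← norm_neg, e]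
      exact hlt
    obtain ⟨w, hw, hwz⟩ := hball this
    have h1 := hf w
    rw [hwz, neg_sq, hf z] at h1
    have h2 : z = w := by linear_combination h1
    subst h2
    apply hf0 z hz
    linear_combination hwz / 2
  have hne : ∀ z ∈ U, f z + f 0 ≠ 0 := fun z hz h ↦ by
    have := hfar z hz
    rw [h, norm_zero] at this
    linarith
  let g : ℂ → ℂ := fun z ↦ ((ε / 2 : ℝ) : ℂ) / (f z + f 0)
  have hεc : ((ε / 2 : ℝ) : ℂ) ≠ 0 := by
    exact_mod_cast (half_pos hε).ne'
  have hgd : DifferentiableOn ℂ g U := fun z hz ↦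
    (differentiableWithinAt_const _).div ((hfd z hz).add_const _) (hne z hz)
  have hgi : InjOn g U := by
    intro z hz w hw h
    have h' : ((ε / 2 : ℝ) : ℂ) / (f z + f 0) = ((ε / 2 : ℝ) : ℂ) / (f w + f 0) := h
    rw [div_eq_div_iff (hne z hz) (hne w hw)] at h'
    have h2 : f z = f w := by
      have := mul_left_cancel₀ hεc h'
      linear_combination -this
    have h3 := hf z
    rw [h2, hf w] at h3
    linear_combination -h3
  have hgm : ∀ z ∈ U, ‖g z‖ < 1 := by
    intro z hz
    have := hfar z hz
    simp only [g]
    rw [norm_div, Complex.norm_real, Real.norm_of_nonneg (half_pos hε).le,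
      div_lt_one (by linarith)]
    linarith
  obtain ⟨h1, h2⟩ := RmFam.of_mob hUo h0 hgd hgi hgm
  refine ⟨_, h1, ?_⟩
  rw [h2]
  refine div_ne_zero ?_ (rmMob_den (hgm 0 h0) (hgm 0 h0))
  have h3 := (hfd.differentiableAt (hUo.mem_nhds h0)).hasDerivAt
  have h4 : HasDerivAt g _ 0 :=
    (hasDerivAt_const (0 : ℂ) ((ε / 2 : ℝ) : ℂ)).div (h3.add_const (f 0)) (hne 0 h0)
  rw [h4.deriv]
  refine div_ne_zero ?_ (pow_ne_zero _ (hne 0 h0))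
  have h5 : deriv f 0 ≠ 0 := fun h ↦ by
    have := hdf 0 h0
    rw [h] at this; simp at this
  simp only [zero_mul, zero_sub]
  exact neg_ne_zero.mpr (mul_ne_zero hεc h5)

theorem rm_koebe {U : Set ℂ} (hUo : IsOpen U) (hUc : IsSimplyConnected U) (h0 : (0 : ℂ) ∈ U)
    {f : ℂ → ℂ} (hf : RmFam U f) (hf' : deriv f 0 ≠ 0) {c : ℂ} (hc : ‖c‖ < 1)
    (hcU : ∀ z ∈ U, f z ≠ c) : ∃ g, RmFam U g ∧ ‖deriv f 0‖ < ‖deriv g 0‖ := by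
  have hdiff0 := (hf.diff.differentiableAt (hUo.mem_nhds h0)).hasDerivAt
  have hqd : DifferentiableOn ℂ (fun z ↦ rmMob c (f z)) U := fun z hz ↦
    ((rmMob_hasDerivAt hc (hf.maps z hz)).differentiableAt).comp_differentiableWithinAt z
      (hf.diff z hz)
  obtain ⟨s, hsd, hs⟩ := rm_sqrt hUo hUc hqd
    (fun z hz ↦ rmMob_ne hc (hf.maps z hz) (hcU z hz))
  have hsi : InjOn s U := by
    intro z hz w hw h
    have h1 := hs z
    rw [h, hs w] at h1
    exact hf.inj hz hw (rmMob_inj hc (hf.maps z hz) (hf.maps w hw) h1.symm)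
  have hsm : ∀ z ∈ U, ‖s z‖ < 1 := by
    intro z hz
    have h1 := rmMob_norm hc (hf.maps z hz)
    rw [← hs z, norm_pow] at h1
    exact (pow_lt_one_iff_of_nonneg (norm_nonneg _) two_ne_zero).mp h1
  obtain ⟨h1, h2⟩ := RmFam.of_mob hUo h0 hsd hsi hsm
  refine ⟨_, h1, ?_⟩
  have hs0 : s 0 ^ 2 = -c := by
    rw [hs 0, hf.zero]; simp [rmMob]
  have hn : ‖s 0‖ ^ 2 = ‖c‖ := by rw [← norm_pow, hs0, norm_neg]
  have hc0 : c ≠ 0 := fun h ↦ hcU 0 h0 (by rw [hf.zero, h])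
  have hder : 2 * s 0 * deriv s 0 = (1 - conj c * c) * deriv f 0 := by
    have e1 := (hsd.differentiableAt (hUo.mem_nhds h0)).hasDerivAt.pow 2
    have e2 := (rmMob_hasDerivAt hc (hf.maps 0 h0)).comp 0 hdiff0
    have e3 : s ^ 2 = rmMob c ∘ f := by ext z; simpa using hs z
    rw [e3] at e1
    have := e1.unique e2
    rw [hf.zero] at this
    simpa using this
  have hr1 : ∀ b : ℂ, ‖b‖ < 1 → ‖1 - conj b * b‖ = 1 - ‖b‖ ^ 2 := by
    intro b hb
    have : 1 - conj b * b = ((1 - ‖b‖ ^ 2 : ℝ) : ℂ) := by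
      rw [mul_comm, Complex.mul_conj, Complex.normSq_eq_norm_sq]; push_cast; rfl
    rw [this, Complex.norm_real, Real.norm_of_nonneg]
    nlinarith [norm_nonneg b]
  have hder2 := congrArg norm hder
  simp only [norm_mul, hr1 c hc, Complex.norm_ofNat] at hder2
  rw [h2, norm_div, hr1 _ (hsm 0 h0)]
  have hp : 0 < ‖s 0‖ := by
    rw [norm_pos_iff]; intro h; rw [h] at hs0; apply hc0; simpa using hs0.symm
  have hlt := hsm 0 h0
  have hfp : 0 < ‖deriv f 0‖ := norm_pos_iff.mpr hf'
  rw [← hn] at hder2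
  set r := ‖s 0‖
  have hr2 : 0 < 1 - r ^ 2 := by nlinarith
  rw [lt_div_iff₀ hr2]
  have h3 : 2 * r * (‖deriv f 0‖ * (1 - r ^ 2)) < 2 * r * ‖deriv s 0‖ := by
    rw [hder2]
    have : 0 < ‖deriv f 0‖ * (1 - r ^ 2) * (1 - r) ^ 2 := by
      have : 0 < 1 - r := by linarith
      positivity
    nlinarith
  exact lt_of_mul_lt_mul_left h3 (by positivity)

theorem rm_lip {U : Set ℂ} {f : ℂ → ℂ} (hf : RmFam U f) {x z : ℂ} {r : ℝ}
    (hr : ball x r ⊆ U) (hz : z ∈ ball x r) : dist (f z) (f x) ≤ 2 / r * dist z x := by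
  refine Complex.dist_le_div_mul_dist_of_mapsTo_ball (hf.diff.mono hr) ?_ hz
  intro w hw
  have hx : x ∈ ball x r := mem_ball_self (pos_of_mem_ball hz)
  rw [mem_closedBall, dist_eq_norm]
  linarith [norm_sub_le (f w) (f x), hf.maps w (hr hw), hf.maps x (hr hx)]

/-- Hurwitz: a locally uniform limit of injective maps is injective or constant. -/
theorem rm_hurwitz {U : Set ℂ} (hUo : IsOpen U) (hUc : IsPreconnected U) {ι : Type*}
    {l : Filter ι} [l.NeBot] {F : ι → ℂ → ℂ} {f : ℂ → ℂ}
    (hF : ∀ n, DifferentiableOn ℂ (F n) U) (hFi : ∀ n, InjOn (F n) U)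
    (hlim : TendstoLocallyUniformlyOn F f l U) (hfd : DifferentiableOn ℂ f U)
    (hnc : ¬ ∃ w, ∀ z ∈ U, f z = w) : InjOn f U := by
  intro a ha b hb hab
  by_contra hne
  have han := hfd.analyticOnNhd hUo
  have hev : ∀ᶠ z in 𝓝[≠] b, f z ≠ f b := by
    rcases (han b hb).eventually_eq_or_eventually_ne (analyticAt_const (v := f b)) with h | h
    · exact absurd ⟨f b, han.eqOn_of_preconnected_of_eventuallyEq analyticOnNhd_const hUc hb h⟩ hnc
    · exact h
  rw [eventually_nhdsWithin_iff] at hev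
  have hall : ∀ᶠ z in 𝓝 b, (z ∈ ({b}ᶜ : Set ℂ) → f z ≠ f b) ∧ z ∈ U ∧ z ≠ a :=
    hev.and ((hUo.eventually_mem hb).and (eventually_ne_nhds (Ne.symm hne)))
  obtain ⟨r, hr, hball⟩ := (nhds_basis_closedBall (x := b)).eventually_iff.mp hall
  have hsub : closedBall b r ⊆ U := fun z hz ↦ (hball hz).2.1
  have hsp : sphere b r ⊆ closedBall b r := sphere_subset_closedBall
  obtain ⟨m, hm, hmin⟩ : ∃ m > 0, ∀ z ∈ sphere b r, m ≤ ‖f z - f b‖ := by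
    have hcont : ContinuousOn (fun z ↦ ‖f z - f b‖) (sphere b r) :=
      ((hfd.continuousOn.mono (hsp.trans hsub)).sub continuousOn_const).norm
    obtain ⟨z, hz, hz2⟩ := (isCompact_sphere b r).exists_isMinOn
      (NormedSpace.sphere_nonempty.mpr hr.le) hcont
    refine ⟨_, ?_, fun w hw ↦ hz2 hw⟩
    rw [gt_iff_lt, norm_pos_iff, sub_ne_zero]
    apply (hball (hsp hz)).1
    rintro rfl
    simp at hz
    exact hr.ne hz
  have hunif : TendstoUniformlyOn F f l (closedBall b r) :=
    (tendstoLocallyUniformlyOn_iff_forall_isCompact hUo).mp hlim _ hsub (isCompact_closedBall b r)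
  have e1 := Metric.tendstoUniformlyOn_iff.mp hunif (m / 8) (by positivity)
  have e2 := Metric.tendsto_nhds.mp (hlim.tendsto_at ha) (m / 8) (by positivity)
  obtain ⟨n, h1, h2⟩ := (e1.and e2).exists
  have hbb : b ∈ closedBall b r := mem_closedBall_self hr.le
  have h3 := h1 b hbb
  have hsub2 : ball (F n b) ((m / 2) / 2) ⊆ F n '' closedBall b r := by
    refine DiffContOnCl.ball_subset_image_closedBall ?_ hr ?_ ?_
    · refine DifferentiableOn.diffContOnCl ?_
      exact (hF n).mono (closure_ball_subset_closedBall.trans hsub)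
    · intro z hz
      have h4 := h1 z (hsp hz)
      have h5 := hmin z hz
      rw [dist_eq_norm] at h3 h4
      have : f z - f b = (f z - F n z) + (F n z - F n b) - (f b - F n b) := by ring
      have h6 : ‖f z - f b‖ ≤ ‖f z - F n z‖ + ‖F n z - F n b‖ + ‖f b - F n b‖ := by
        rw [this]
        exact (norm_sub_le _ _).trans (by gcongr; exact norm_add_le _ _)
      linarith
    · have : ∀ᶠ z in 𝓝[≠] b, F n z ≠ F n b := by
        filter_upwards [self_mem_nhdsWithin,
          nhdsWithin_le_nhds (hUo.mem_nhds hb)] with z hz hzU h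
        exact hz (hFi n hzU hb h)
      exact this.frequently.filter_mono nhdsWithin_le_nhds
  have hmem : F n a ∈ ball (F n b) ((m / 2) / 2) := by
    rw [mem_ball]
    rw [hab] at h2
    linarith [dist_triangle (F n a) (f b) (F n b)]
  obtain ⟨w, hw, hwa⟩ := hsub2 hmem
  exact (hball hw).2.2 (hFi n (hsub hw) ha hwa)

theorem rm_extremal {U : Set ℂ} (hUo : IsOpen U) (hUc : IsSimplyConnected U) (h0 : (0 : ℂ) ∈ U)
    (hU : U ≠ univ) : ∃ f, RmFam U f ∧ deriv f 0 ≠ 0 ∧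
      ∀ g, RmFam U g → ‖deriv g 0‖ ≤ ‖deriv f 0‖ := by
  have hpre : IsPreconnected U := hUc.isPathConnected.isConnected.isPreconnected
  obtain ⟨f₀, hf₀, hf₀'⟩ := rm_nonempty hUo hUc h0 hU
  let S : Set ℝ := {t | ∃ f, RmFam U f ∧ ‖deriv f 0‖ = t}
  have hSne : S.Nonempty := ⟨_, f₀, hf₀, rfl⟩
  obtain ⟨r₀, hr₀, hr₀U⟩ := Metric.isOpen_iff.mp hUo 0 h0
  have hSb : BddAbove S := by
    refine ⟨1 / r₀, ?_⟩
    rintro t ⟨f, hf, rfl⟩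
    refine Complex.norm_deriv_le_div_of_mapsTo_ball (hf.diff.mono hr₀U) ?_ hr₀
    intro w hw
    rw [hf.zero, mem_closedBall_zero_iff]
    exact (hf.maps w (hr₀U hw)).le
  obtain ⟨u, -, hu, huS⟩ := exists_seq_tendsto_sSup hSne hSb
  choose F hF hFu using huS
  let l : Ultrafilter ℕ := hyperfilter ℕ
  have hl : (l : Filter ℕ) ≤ atTop := by
    rw [← Nat.cofinite_eq_atTop]; exact hyperfilter_le_cofinite
  have hex : ∀ z, ∃ w, z ∈ U → ‖w‖ ≤ 1 ∧ Tendsto (fun n ↦ F n z) l (𝓝 w) := by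
    intro z
    by_cases hz : z ∈ U
    · have hmem : closedBall (0 : ℂ) 1 ∈ l.map (fun n ↦ F n z) := by
        rw [Ultrafilter.mem_map]
        refine Filter.univ_mem' fun n ↦ ?_
        simpa using ((hF n).maps z hz).le
      obtain ⟨w, hw, hw2⟩ := (isCompact_closedBall (0 : ℂ) 1).ultrafilter_le_nhds
        (l.map (fun n ↦ F n z)) (Filter.le_principal_iff.mpr hmem)
      exact ⟨w, fun _ ↦ ⟨by simpa using hw, hw2⟩⟩
    · exact ⟨0, fun h ↦ absurd h hz⟩
  choose f hf using hex
  have hlim : TendstoLocallyUniformlyOn F f l U := by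
    rw [Metric.tendstoLocallyUniformlyOn_iff]
    intro ε hε x hx
    obtain ⟨r, hr, hrU⟩ := Metric.isOpen_iff.mp hUo x hx
    have hpos : 0 < min r (ε * r / 8) := lt_min hr (by positivity)
    refine ⟨ball x (min r (ε * r / 8)), mem_nhdsWithin_of_mem_nhds (ball_mem_nhds x hpos), ?_⟩
    filter_upwards [Metric.tendsto_nhds.mp (hf x hx).2 (ε / 4) (by positivity)] with n hn z hz
    have hz1 : z ∈ ball x r := ball_subset_ball (min_le_left _ _) hz
    have hz2 : 2 / r * dist z x ≤ ε / 4 := by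
      have : dist z x < ε * r / 8 := (mem_ball.mp hz).trans_le (min_le_right _ _)
      rw [div_mul_eq_mul_div, div_le_iff₀ hr]
      linarith
    have hL : ∀ n, dist (F n z) (F n x) ≤ ε / 4 := fun n ↦ (rm_lip (hF n) hrU hz1).trans hz2
    have hL' : dist (f z) (f x) ≤ ε / 4 :=
      le_of_tendsto ((hf z (hrU hz1)).2.dist (hf x hx).2) (Eventually.of_forall hL)
    have := hL n
    rw [dist_comm] at this
    rw [dist_comm] at hn
    linarith [dist_triangle4 (f z) (f x) (F n x) (F n z)]
  have hfd : DifferentiableOn ℂ f U :=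
    hlim.differentiableOn (Eventually.of_forall fun n ↦ (hF n).diff) hUo
  have hder : Tendsto (fun n ↦ ‖deriv (F n) 0‖) l (𝓝 ‖deriv f 0‖) :=
    ((hlim.deriv (Eventually.of_forall fun n ↦ (hF n).diff) hUo).tendsto_at h0).norm
  have hsup : ‖deriv f 0‖ = sSup S := by
    refine tendsto_nhds_unique hder ?_
    simp only [hFu]
    exact hu.mono_left hl
  have hmax : ∀ g, RmFam U g → ‖deriv g 0‖ ≤ ‖deriv f 0‖ := by
    intro g hg
    rw [hsup]
    exact le_csSup hSb ⟨g, hg, rfl⟩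
  have hne : deriv f 0 ≠ 0 := by
    have := hmax f₀ hf₀
    rw [← norm_pos_iff] at hf₀' ⊢
    linarith
  have hnc : ¬ ∃ w, ∀ z ∈ U, f z = w := by
    rintro ⟨w, hw⟩
    apply hne
    have : f =ᶠ[𝓝 0] fun _ ↦ w := by
      filter_upwards [hUo.mem_nhds h0] with z hz using hw z hz
    rw [this.deriv_eq]; simp
  refine ⟨f, ⟨hfd, ?_, ?_, ?_⟩, hne, hmax⟩
  · exact rm_hurwitz hUo hpre (fun n ↦ (hF n).diff) (fun n ↦ (hF n).inj) hlim hfd hnc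
  · have hopen : IsOpen (f '' U) := by
      rcases (hfd.analyticOnNhd hUo).is_constant_or_isOpen hpre with h | h
      · exact absurd h hnc
      · exact h U subset_rfl hUo
    have hsub : f '' U ⊆ closedBall 0 1 := by
      rintro _ ⟨z, hz, rfl⟩
      simpa using (hf z hz).1
    have h1 := interior_maximal hsub hopen
    rw [interior_closedBall _ one_ne_zero] at h1
    intro z hz
    simpa using h1 ⟨z, hz, rfl⟩
  · refine tendsto_nhds_unique (hf 0 h0).2 ?_
    simp only [(hF _).zero]
    exact tendsto_const_nhds

/-- Riemann mapping theorem, normalised at the origin. -/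
theorem rm_riemann {U : Set ℂ} (hUo : IsOpen U) (hUc : IsSimplyConnected U) (h0 : (0 : ℂ) ∈ U)
    (hU : U ≠ univ) : ∃ f, RmFam U f ∧ deriv f 0 ≠ 0 ∧ ∀ c : ℂ, ‖c‖ < 1 → ∃ z ∈ U, f z = c := by
  obtain ⟨f, hf, hf', hmax⟩ := rm_extremal hUo hUc h0 hU
  refine ⟨f, hf, hf', fun c hc ↦ ?_⟩
  by_contra! hcU
  obtain ⟨g, hg, hlt⟩ := rm_koebe hUo hUc h0 hf hf' hc hcU
  exact (hmax g hg).not_gt hlt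

theorem rm_convex_sc {s : Set ℂ} (hs : Convex ℝ s) (hne : s.Nonempty) :
    SimplyConnectedSpace s := by
  have := hs.contractibleSpace hne
  infer_instance

theorem rm_sc (D : Set ℂ) (hD : IsOpen D) (hsc : SimplyConnectedSpace ↥D) (h0 : (0 : ℂ) ∈ D) :
    SimplyConnectedSpace ↥{z : ℂ | z ^ 2 ∈ D} := by
  by_cases hU : D = univ
  · subst hU
    exact rm_convex_sc (by simpa using convex_univ) ⟨0, by simp⟩
  have hUc : IsSimplyConnected D := hsc
  have hpre : IsPreconnected D := hUc.isPathConnected.isConnected.isPreconnected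
  obtain ⟨f, hf, hf', hsurj⟩ := rm_riemann hD hUc h0 hU
  -- the inverse of `f`
  have hopen : ∀ s ⊆ D, IsOpen s → IsOpen (f '' s) := by
    rcases (hf.diff.analyticOnNhd hD).is_constant_or_isOpen hpre with ⟨w, hw⟩ | h
    · exfalso
      apply hf'
      have : f =ᶠ[𝓝 0] fun _ ↦ w := by
        filter_upwards [hD.mem_nhds h0] with z hz using hw z hz
      rw [this.deriv_eq]; simp
    · exact h
  have hex : ∀ c : ℂ, ∃ z, ‖c‖ < 1 → z ∈ D ∧ f z = c := by
    intro c
    by_cases hc : ‖c‖ < 1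
    · obtain ⟨z, hz⟩ := hsurj c hc
      exact ⟨z, fun _ ↦ hz⟩
    · exact ⟨0, fun h ↦ absurd h hc⟩
  choose g hg using hex
  have hgc : ContinuousOn g (ball 0 1) := by
    intro c hc
    refine ContinuousAt.continuousWithinAt ?_
    have hc1 : ‖c‖ < 1 := by simpa using hc
    intro V hV
    obtain ⟨W, hWV, hWo, hcW⟩ := _root_.mem_nhds_iff.mp hV
    have h1 := hopen (W ∩ D) inter_subset_right (hWo.inter hD)
    have h2 : c ∈ f '' (W ∩ D) := ⟨g c, ⟨hcW, (hg c hc1).1⟩, (hg c hc1).2⟩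
    rw [Filter.mem_map]
    filter_upwards [h1.mem_nhds h2, isOpen_ball.mem_nhds hc] with e he he1
    obtain ⟨z, ⟨hzW, hzD⟩, rfl⟩ := he
    have he2 : ‖f z‖ < 1 := hf.maps z hzD
    have := hf.inj (hg _ he2).1 hzD (hg _ he2).2
    rw [mem_preimage, this]
    exact hWV hzW
  -- the square root of `f w / w`
  have hhd : ContinuousOn (dslope f 0) D :=
    (continuousOn_dslope (hD.mem_nhds h0)).mpr
      ⟨hf.diff.continuousOn, hf.diff.differentiableAt (hD.mem_nhds h0)⟩
  have hh0 : ∀ z ∈ D, dslope f 0 z ≠ 0 := by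
    intro z hz
    by_cases h : z = 0
    · rw [h, dslope_same]; exact hf'
    · rw [dslope_of_ne _ h, slope_def_field, hf.zero]
      refine div_ne_zero ?_ (by simpa using h)
      intro h2
      apply h
      apply hf.inj hz h0
      rw [hf.zero]; linear_combination h2
  obtain ⟨k, hkc, hk⟩ := Complex.exists_continuousOn_pow_eq hUc hD hhd
    (by rintro ⟨z, hz, h⟩; exact hh0 z hz h) two_ne_zero
  have hk0 : ∀ z ∈ D, k z ≠ 0 := fun z hz h ↦ hh0 z hz (by rw [← hk, h]; simp)
  have hfk : ∀ z, f z = z * k z ^ 2 := by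
    intro z
    rw [hk]
    have := sub_smul_dslope f 0 z
    rw [hf.zero] at this
    simpa using this.symm
  have hFsq : ∀ z, (z * k (z ^ 2)) ^ 2 = f (z ^ 2) := fun z ↦ by rw [hfk]; ring
  have hnorm : ∀ u : ℂ, ‖u‖ < 1 → ‖u ^ 2‖ < 1 := fun u hu ↦ by
    rw [norm_pow]; exact pow_lt_one₀ (norm_nonneg _) hu two_ne_zero
  have hGsq : ∀ u : ℂ, ‖u‖ < 1 → (u / k (g (u ^ 2))) ^ 2 = g (u ^ 2) := by
    intro u hu
    obtain ⟨h1, h2⟩ := hg _ (hnorm u hu)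
    have h3 := hk0 _ h1
    rw [hfk] at h2
    rw [div_pow, div_eq_iff (pow_ne_zero _ h3), h2]
  let e : ↥{z : ℂ | z ^ 2 ∈ D} ≃ₜ ↥(ball (0 : ℂ) 1) :=
    { toFun := fun z ↦ ⟨z.1 * k (z.1 ^ 2), by
        have h := hf.maps _ z.2
        rw [← hFsq, norm_pow] at h
        simpa using (pow_lt_one_iff_of_nonneg (norm_nonneg _) two_ne_zero).mp h⟩
      invFun := fun u ↦ ⟨u.1 / k (g (u.1 ^ 2)), by
        have hu : ‖u.1‖ < 1 := mem_ball_zero_iff.mp u.2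
        change _ ^ 2 ∈ D
        rw [hGsq _ hu]
        exact (hg _ (hnorm _ hu)).1⟩
      left_inv := by
        rintro ⟨z, hz⟩
        have hz' : z ^ 2 ∈ D := hz
        apply Subtype.ext
        have h1 : g (f (z ^ 2)) = z ^ 2 :=
          hf.inj (hg _ (hf.maps _ hz')).1 hz' (hg _ (hf.maps _ hz')).2
        simp only [hFsq, h1]
        rw [mul_div_cancel_right₀ _ (hk0 _ hz')]
      right_inv := by
        rintro ⟨u, hu⟩
        have hu1 : ‖u‖ < 1 := by simpa using hu
        apply Subtype.ext
        simp only [hGsq u hu1]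
        rw [div_mul_cancel₀ _ (hk0 _ (hg _ (hnorm u hu1)).1)]
      continuous_toFun := by
        refine Continuous.subtype_mk ?_ _
        refine continuous_subtype_val.mul ?_
        exact hkc.comp_continuous (continuous_subtype_val.pow 2) (fun z ↦ z.2)
      continuous_invFun := by
        refine Continuous.subtype_mk ?_ _
        have hu : ∀ u : ↥(ball (0 : ℂ) 1), ‖u.1‖ < 1 := fun u ↦ mem_ball_zero_iff.mp u.2
        refine continuous_subtype_val.div ?_ (fun u ↦ hk0 _ (hg _ (hnorm _ (hu u))).1)
        refine hkc.comp_continuous ?_ (fun u ↦ (hg _ (hnorm _ (hu u))).1)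
        exact hgc.comp_continuous (continuous_subtype_val.pow 2)
          (fun u ↦ by simpa using hnorm _ (hu u)) }
  have := rm_convex_sc (convex_ball (0 : ℂ) 1) ⟨0, by simp⟩
  exact e.toHomotopyEquiv.simplyConnectedSpace

/- STATEMENT 14: if D ⊆ ℂ is open, simply connected and 0 ∈ D, then the
preimage Q⁻¹(D) = {z | z² ∈ D} of D under the squaring map is connected and
simply connected. -/
theorem preimage_sq_connected_simply_connected
    (D : Set ℂ) (hD : IsOpen D) (hsc : SimplyConnectedSpace ↥D) (h0 : (0 : ℂ) ∈ D) :
    IsConnected {z : ℂ | z ^ 2 ∈ D} ∧ SimplyConnectedSpace ↥{z : ℂ | z ^ 2 ∈ D} := by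
  have h := rm_sc D hD hsc h0
  have h2 : IsSimplyConnected {z : ℂ | z ^ 2 ∈ D} := h
  exact ⟨h2.isPathConnected.isConnected, h⟩
end
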